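/- arXiv:1805.03095 — 6 statements merged into one kernel-verified Lean document; each statement's English description precedes it below -/
import Mathlib

section
/- Theorem 1 (Erasure jamming achievability): Fix a multipath network with C links, an innocent distribution P^inn_X on 𝒳, and a nonnegative integer Z < C/2 such that the feasible set of optimization (A) is nonempty, and fix any ε with 0 < ε < K̄(P^inn_X, Z). Then the rate R = K̄(P^inn_X, Z) − ε is achievable under erasure jamming: there exists a sequence of blocklength-n codes, each of rate at least R, that is stealthy (for every J ∈ 𝔍, V(P̂_{X_J}, (P^inn_{X_J})ⁿ) → 0 as n → ∞) and whose erasure error probability tends to 0 as n → ∞. -/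
open scoped BigOperators Classical
open Filter

noncomputable section

/-- A probability mass function on a finite type, viewed as a real-valued function. -/
def IsPMF {α : Type} [Fintype α] (p : α → ℝ) : Prop :=
  (∀ a, 0 ≤ p a) ∧ ∑ a, p a = 1

/-- Shannon entropy in bits. -/
def H2 {α : Type} [Fintype α] (p : α → ℝ) : ℝ :=
  -∑ a, p a * Real.logb 2 (p a)

/-- Total variation distance between two PMFs. -/
def tvDist {α : Type} [Fintype α] (p q : α → ℝ) : ℝ :=
  (1 / 2) * ∑ a, |p a - q a|

def margFst {α β : Type} [Fintype α] [Fintype β] (p : α × β → ℝ) : α → ℝ :=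
  fun a => ∑ b, p (a, b)

def margSnd {α β : Type} [Fintype α] [Fintype β] (p : α × β → ℝ) : β → ℝ :=
  fun b => ∑ a, p (a, b)

/-- Mutual information in bits of a joint PMF. -/
def MI2 {α β : Type} [Fintype α] [Fintype β] (p : α × β → ℝ) : ℝ :=
  H2 (margFst p) + H2 (margSnd p) - H2 p

/-- The n-fold product (memoryless) extension of a PMF. -/
def prodPMF {α : Type} [Fintype α] (p : α → ℝ) (n : ℕ) : (Fin n → α) → ℝ :=
  fun v => ∏ t, p (v t)

/-- Restriction of a network symbol to the links in `J`. -/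
def restr {C : ℕ} {X : Fin C → Type} (J : Finset (Fin C)) (x : ∀ i, X i) :
    (i : {i // i ∈ J}) → X i.1 :=
  fun i => x i.1

/-- Marginal of a PMF on the product alphabet on the links in `J`. -/
def marg {C : ℕ} {X : Fin C → Type} [∀ i, Fintype (X i)]
    (p : (∀ i, X i) → ℝ) (J : Finset (Fin C)) :
    ((i : {i // i ∈ J}) → X i.1) → ℝ :=
  fun y => ∑ x : ∀ i, X i, if restr J x = y then p x else 0

/-- The family 𝔍 of subsets of links of size at most `Z`. -/
def Jsets (C Z : ℕ) : Finset (Finset (Fin C)) :=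
  Finset.univ.filter (fun J => J.card ≤ Z)

lemma Jsets_nonempty (C Z : ℕ) : (Jsets C Z).Nonempty :=
  ⟨∅, by simp [Jsets]⟩

/-- Joint law of `(U, X_J)` induced by `P_U` and the channel `k = P_{X|U}`. -/
def jointUXJ {C : ℕ} {X : Fin C → Type} [∀ i, Fintype (X i)] {U : Type} [Fintype U]
    (pU : U → ℝ) (k : U → (∀ i, X i) → ℝ) (J : Finset (Fin C)) :
    U × ((i : {i // i ∈ J}) → X i.1) → ℝ :=
  fun q => pU q.1 * marg (k q.1) J q.2

/-- Feasibility for optimization (A). -/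
def FeasibleA {C : ℕ} (X : Fin C → Type) [∀ i, Fintype (X i)]
    (pinn : (∀ i, X i) → ℝ) (Z : ℕ)
    (U : Type) [Fintype U] (pU : U → ℝ) (k : U → (∀ i, X i) → ℝ) : Prop :=
  IsPMF pU ∧ (∀ u, IsPMF (k u)) ∧
  (∀ J ∈ Jsets C Z, marg (fun x => ∑ u, pU u * k u x) J = marg pinn J) ∧
  ((Jsets C Z).sup' (Jsets_nonempty C Z) (fun J => MI2 (jointUXJ pU k J)) <
    (Jsets C Z).inf' (Jsets_nonempty C Z) (fun J => MI2 (jointUXJ pU k Jᶜ)))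

/-- Objective value of optimization (A). -/
def objA {C : ℕ} {X : Fin C → Type} [∀ i, Fintype (X i)] {U : Type} [Fintype U]
    (pU : U → ℝ) (k : U → (∀ i, X i) → ℝ) (Z : ℕ) : ℝ :=
  (Jsets C Z).inf' (Jsets_nonempty C Z) (fun J => MI2 (jointUXJ pU k Jᶜ))

/-- The set of objective values of feasible points of optimization (A). -/
def KbarSet {C : ℕ} (X : Fin C → Type) [∀ i, Fintype (X i)]
    (pinn : (∀ i, X i) → ℝ) (Z : ℕ) : Set ℝ :=
  {r | ∃ (U : Type) (inst : Fintype U) (pU : U → ℝ) (k : U → (∀ i, X i) → ℝ),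
    @FeasibleA C X _ pinn Z U inst pU k ∧ r = @objA C X _ U inst pU k Z}

/-- `K̄(P^inn_X, Z)`, the value of optimization (A). -/
def Kbar {C : ℕ} (X : Fin C → Type) [∀ i, Fintype (X i)]
    (pinn : (∀ i, X i) → ℝ) (Z : ℕ) : ℝ :=
  sSup (KbarSet X pinn Z)

/-- Feasibility for optimization (B). -/
def FeasibleB {C : ℕ} (X : Fin C → Type) [∀ i, Fintype (X i)]
    (pinn : (∀ i, X i) → ℝ) (Z : ℕ) (pX : (∀ i, X i) → ℝ) : Prop :=
  IsPMF pX ∧ (∀ J ∈ Jsets C Z, marg pX J = marg pinn J) ∧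
  ((Jsets C Z).sup' (Jsets_nonempty C Z) (fun J => H2 (marg pX J)) <
    (Jsets C Z).inf' (Jsets_nonempty C Z) (fun J => H2 (marg pX Jᶜ)))

/-- Objective value of optimization (B). -/
def objB {C : ℕ} {X : Fin C → Type} [∀ i, Fintype (X i)]
    (pX : (∀ i, X i) → ℝ) (Z : ℕ) : ℝ :=
  (Jsets C Z).inf' (Jsets_nonempty C Z) (fun J => H2 (marg pX Jᶜ))

/-- `K̲(P^inn_X, Z)`, the value of optimization (B). -/
def Kunder {C : ℕ} (X : Fin C → Type) [∀ i, Fintype (X i)]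
    (pinn : (∀ i, X i) → ℝ) (Z : ℕ) : ℝ :=
  sSup {r | ∃ pX : (∀ i, X i) → ℝ, FeasibleB X pinn Z pX ∧ r = objB pX Z}

/-- The active distribution marginalized to the links in `J` (n-letter). -/
def activeMarg {C : ℕ} {X : Fin C → Type} [∀ i, Fintype (X i)] {n N : ℕ}
    (enc : Fin N → (Fin n → ∀ i, X i) → ℝ) (J : Finset (Fin C)) :
    (Fin n → (i : {i // i ∈ J}) → X i.1) → ℝ :=
  fun w => (1 / N : ℝ) * ∑ m, ∑ v : Fin n → ∀ i, X i,
    if (fun t => restr J (v t)) = w then enc m v else 0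

/-- Error probability under erasure jamming. -/
def erasureErr {C : ℕ} {X : Fin C → Type} [∀ i, Fintype (X i)] {n N : ℕ}
    (pinn : (∀ i, X i) → ℝ) (Z : ℕ)
    (enc : Fin N → (Fin n → ∀ i, X i) → ℝ)
    (dec : (J : Finset (Fin C)) →
      (Fin n → (i : {i // i ∈ Jᶜ}) → X i.1) → Option (Fin N)) : ℝ :=
  (Jsets C Z).sup' (Jsets_nonempty C Z) (fun J =>
    (∑ v : Fin n → ∀ i, X i, prodPMF pinn n v *
      (if dec J (fun t => restr Jᶜ (v t)) ≠ none then 1 else 0)) +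
    (1 / N : ℝ) * ∑ m, ∑ v : Fin n → ∀ i, X i, enc m v *
      (if dec J (fun t => restr Jᶜ (v t)) ≠ some m then 1 else 0))


lemma sum_prod_pi {n : ℕ} {α : Type} [Fintype α] (f : Fin n → α → ℝ) :
    ∑ v : Fin n → α, ∏ t, f t (v t) = ∏ t, ∑ x, f t x := by
  rw [Finset.prod_univ_sum, Fintype.piFinset_univ]

lemma prodPMF_isPMF {α : Type} [Fintype α] {p : α → ℝ} (hp : IsPMF p) (n : ℕ) :
    IsPMF (prodPMF p n) := by
  refine ⟨fun v => Finset.prod_nonneg fun t _ => hp.1 _, ?_⟩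
  unfold prodPMF
  rw [sum_prod_pi (fun _ => p)]
  simp [hp.2]

lemma sum_cons {n : ℕ} {α : Type} [Fintype α] (F : (Fin (n+1) → α) → ℝ) :
    ∑ z, F z = ∑ x, ∑ z, F (Fin.cons x z) := by
  rw [← Fintype.sum_prod_type']
  exact (Fintype.sum_equiv (Fin.consEquiv (fun _ : Fin (n+1) => α)) _ _ (fun x => rfl)).symm

lemma second_moment {α : Type} [Fintype α] {p : α → ℝ} (hp : IsPMF p) (f : α → ℝ)
    (hf : ∑ x, p x * f x = 0) (n : ℕ) :
    ∑ z, prodPMF p n z * (∑ t, f (z t)) ^ 2 = n * ∑ x, p x * f x ^ 2 := by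
  induction n with
  | zero => simp
  | succ n ih =>
    rw [sum_cons]
    have h1 := (prodPMF_isPMF hp n).2
    have key : ∀ x, ∑ z : Fin n → α, prodPMF p (n+1) (Fin.cons x z) *
        (∑ t, f ((Fin.cons x z : Fin (n+1) → α) t)) ^ 2
        = p x * f x ^ 2 + (p x * f x) * (2 * ∑ z, prodPMF p n z * ∑ t, f (z t))
          + p x * (n * ∑ x, p x * f x ^ 2) := by
      intro x
      rw [← ih]
      have : p x * f x ^ 2 = p x * f x ^ 2 * ∑ z, prodPMF p n z := by rw [h1, mul_one]
      rw [this, Finset.mul_sum, Finset.mul_sum, Finset.mul_sum, Finset.mul_sum,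
        ← Finset.sum_add_distrib, ← Finset.sum_add_distrib]
      refine Finset.sum_congr rfl fun z _ => ?_
      simp only [prodPMF, Fin.prod_univ_succ, Fin.sum_univ_succ, Fin.cons_zero, Fin.cons_succ]
      ring
    simp only [key]
    rw [Finset.sum_add_distrib, Finset.sum_add_distrib, ← Finset.sum_mul, ← Finset.sum_mul,
      hf, hp.2]
    push_cast
    ring

lemma exp_one {α : Type} [Fintype α] {p : α → ℝ} (hp : IsPMF p) {N : ℕ} (m : Fin N)
    (g : α → ℝ) : ∑ c, prodPMF p N c * g (c m) = ∑ x, p x * g x := by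
  have := sum_prod_pi (fun (t : Fin N) (x : α) => p x * (if t = m then g x else 1))
  simp only [Finset.prod_mul_distrib, Finset.prod_ite_eq', Finset.mem_univ, if_true] at this
  unfold prodPMF
  rw [this, ← Finset.mul_prod_erase _ _ (Finset.mem_univ m)]
  rw [Finset.prod_eq_one]
  · simp
  · intro t ht
    have : t ≠ m := (Finset.mem_erase.1 ht).1
    simp [this, hp.2]

lemma exp_two {α : Type} [Fintype α] {p : α → ℝ} (hp : IsPMF p) {N : ℕ} (m m' : Fin N)
    (hm : m ≠ m') (g h : α → ℝ) :
    ∑ c, prodPMF p N c * (g (c m) * h (c m')) = (∑ x, p x * g x) * ∑ x, p x * h x := by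
  have := sum_prod_pi (fun (t : Fin N) (x : α) => p x * ((if t = m then g x else 1)
    * (if t = m' then h x else 1)))
  simp only [Finset.prod_mul_distrib, Finset.prod_ite_eq', Finset.mem_univ, if_true] at this
  unfold prodPMF
  rw [this, ← Finset.mul_prod_erase _ _ (Finset.mem_univ m),
    ← Finset.mul_prod_erase _ _ (Finset.mem_erase.2 ⟨hm.symm, Finset.mem_univ m'⟩)]
  rw [Finset.prod_eq_one]
  · simp [hm, hm.symm]
  · intro t ht
    have h1 : t ≠ m' := (Finset.mem_erase.1 ht).1
    have h2 : t ≠ m := (Finset.mem_erase.1 (Finset.mem_erase.1 ht).2).1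
    simp [h1, h2, hp.2]

lemma push_prod {n : ℕ} {α β : Type} [Fintype α] [Fintype β] (p : Fin n → α → ℝ) (g : α → β)
    (F : (Fin n → β) → ℝ) :
    ∑ v : Fin n → α, (∏ t, p t (v t)) * F (fun t => g (v t))
      = ∑ w : Fin n → β, (∏ t, ∑ x, if g x = w t then p t x else 0) * F w := by
  have h : ∀ w : Fin n → β, (∏ t, ∑ x, if g x = w t then p t x else 0)
      = ∑ v : Fin n → α, if (fun t => g (v t)) = w then ∏ t, p t (v t) else 0 := by
    intro w
    rw [← sum_prod_pi (fun t x => if g x = w t then p t x else 0)]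
    refine Finset.sum_congr rfl fun v _ => ?_
    by_cases hv : (fun t => g (v t)) = w
    · rw [if_pos hv]
      refine Finset.prod_congr rfl fun t _ => ?_
      rw [if_pos (congrFun hv t)]
    · rw [if_neg hv]
      obtain ⟨t, ht⟩ := Function.ne_iff.1 hv
      exact Finset.prod_eq_zero (Finset.mem_univ t) (if_neg ht)
  simp only [h, Finset.sum_mul]
  rw [Finset.sum_comm]
  refine Finset.sum_congr rfl fun v _ => ?_
  rw [Finset.sum_eq_single (fun t => g (v t))]
  · simp
  · intro b _ hb
    rw [if_neg (Ne.symm hb), zero_mul]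
  · simp

lemma cheby {α : Type} [Fintype α] {p : α → ℝ} (hp : IsPMF p) (f : α → ℝ)
    (hf : ∑ x, p x * f x = 0) (δ : ℝ) (hδ : 0 < δ) :
    ∃ a : ℕ → ℝ, Tendsto a atTop (nhds 0) ∧ ∀ (n : ℕ) (S : (Fin n → α) → Prop),
      (∀ z, S z → n * δ ≤ |∑ t, f (z t)|) →
      ∑ z, prodPMF p n z * (if S z then 1 else 0) ≤ a n := by
  set σ := ∑ x, p x * f x ^ 2 with hσ
  refine ⟨fun n => ((σ + δ ^ 2) / δ ^ 2) * (1 / ((n : ℝ) + 1)), ?_, ?_⟩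
  · simpa using tendsto_one_div_add_atTop_nhds_zero_nat.const_mul ((σ + δ ^ 2) / δ ^ 2)
  intro n S hS
  have hP := prodPMF_isPMF hp n
  set P := ∑ z, prodPMF p n z * (if S z then 1 else 0) with hPdef
  have h1 : P ≤ 1 := by
    rw [← hP.2]
    refine Finset.sum_le_sum fun z _ => ?_
    have := hP.1 z
    split_ifs <;> linarith
  have h2 : (n * δ) ^ 2 * P ≤ n * σ := by
    rw [hσ, ← second_moment hp f hf n, hPdef, Finset.mul_sum]
    refine Finset.sum_le_sum fun z _ => ?_
    have := hP.1 z
    split_ifs with hz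
    · have h3 := hS z hz
      have h4 : (n * δ) ^ 2 ≤ (∑ t, f (z t)) ^ 2 := by
        rw [← sq_abs (∑ t, f (z t))]
        exact pow_le_pow_left₀ (by positivity) h3 2
      nlinarith
    · simp; positivity
  have hσ0 : 0 ≤ σ := Finset.sum_nonneg fun x _ => mul_nonneg (hp.1 x) (sq_nonneg _)
  have hn : (0 : ℝ) ≤ n := Nat.cast_nonneg n
  have h3 : n * δ ^ 2 * P ≤ σ := by
    rcases Nat.eq_zero_or_pos n with h0 | h0
    · subst h0; simpa using hσ0
    · have : (0 : ℝ) < n := by exact_mod_cast h0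
      refine le_of_mul_le_mul_left (a := (n : ℝ)) ?_ this
      calc _ = (n * δ) ^ 2 * P := by ring
        _ ≤ _ := h2
  show P ≤ (σ + δ ^ 2) / δ ^ 2 * (1 / ((n : ℝ) + 1))
  rw [div_mul_div_comm, le_div_iff₀ (by positivity)]
  have := mul_le_mul_of_nonneg_left h1 (sq_nonneg δ)
  nlinarith

lemma soft_point {A : Type} [Fintype A] {p : A → ℝ} (hp : IsPMF p) (w : A → ℝ)
    (hw : ∀ a, 0 ≤ w a) (θ : ℝ) (hθ : 0 ≤ θ) (N : ℕ) (hN : 1 ≤ N) (μ : ℝ)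
    (hμ : μ = ∑ a, p a * w a) :
    ∑ c, prodPMF p N c * |(1 / N : ℝ) * ∑ m, w (c m) - μ|
      ≤ 2 * ∑ a, p a * (if θ * μ < w a then w a else 0) + Real.sqrt (θ / N) * μ := by
  have hP := prodPMF_isPMF hp N
  have hN0 : (0 : ℝ) < N := by exact_mod_cast hN
  have hμ0 : 0 ≤ μ := hμ ▸ Finset.sum_nonneg fun a _ => mul_nonneg (hp.1 a) (hw a)
  set w1 : A → ℝ := fun a => if θ * μ < w a then 0 else w a with hw1
  set w2 : A → ℝ := fun a => if θ * μ < w a then w a else 0 with hw2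
  have hsum : ∀ a, w a = w1 a + w2 a := fun a => by simp only [hw1, hw2]; split_ifs <;> simp
  have hw10 : ∀ a, 0 ≤ w1 a := fun a => by
    simp only [hw1]; split_ifs; exacts [le_rfl, hw a]
  have hw20 : ∀ a, 0 ≤ w2 a := fun a => by
    simp only [hw2]; split_ifs; exacts [hw a, le_rfl]
  have hw1θ : ∀ a, w1 a ≤ θ * μ := fun a => by
    simp only [hw1]; split_ifs with h; exacts [by positivity, not_lt.1 h]
  set μ1 := ∑ a, p a * w1 a with hμ1
  set μ2 := ∑ a, p a * w2 a with hμ2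
  have hμ12 : μ = μ1 + μ2 := by
    rw [hμ, hμ1, hμ2, ← Finset.sum_add_distrib]
    exact Finset.sum_congr rfl fun a _ => by rw [hsum a]; ring
  have hμ20 : 0 ≤ μ2 := Finset.sum_nonneg fun a _ => mul_nonneg (hp.1 a) (hw20 a)
  have hμ10 : 0 ≤ μ1 := Finset.sum_nonneg fun a _ => mul_nonneg (hp.1 a) (hw10 a)
  have step : ∀ c : Fin N → A, |(1 / N : ℝ) * ∑ m, w (c m) - μ| ≤
      |(1 / N : ℝ) * ∑ m, (w1 (c m) - μ1)| + ((1 / N : ℝ) * ∑ m, w2 (c m) + μ2) := by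
    intro c
    have e : (1 / N : ℝ) * ∑ m, w (c m) - μ =
      ((1 / N : ℝ) * ∑ m, (w1 (c m) - μ1)) + ((1 / N : ℝ) * ∑ m, w2 (c m) - μ2) := by
      simp only [hsum, Finset.sum_add_distrib, Finset.sum_sub_distrib, hμ12]
      simp
      field_simp
      ring
    rw [e]
    refine (abs_add_le _ _).trans (add_le_add le_rfl ?_)
    have h0 : 0 ≤ (1 / N : ℝ) * ∑ m, w2 (c m) :=
      mul_nonneg (by positivity) (Finset.sum_nonneg fun m _ => hw20 _)
    rw [abs_le]; constructor <;> linarith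
  have hE2 : ∑ c, prodPMF p N c * ((1 / N : ℝ) * ∑ m, w2 (c m) + μ2) = 2 * μ2 := by
    simp only [mul_add, Finset.sum_add_distrib, ← Finset.sum_mul, hP.2]
    have : ∑ c, prodPMF p N c * ((1 / N : ℝ) * ∑ m, w2 (c m))
        = (1 / N : ℝ) * ∑ m : Fin N, ∑ c, prodPMF p N c * w2 (c m) := by
      rw [Finset.sum_comm, Finset.mul_sum]
      refine Finset.sum_congr rfl fun c _ => ?_
      rw [← Finset.mul_sum]; ring
    rw [this]
    simp only [exp_one hp]
    simp
    field_simp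
    ring
  have hE1 : ∑ c, prodPMF p N c * |(1 / N : ℝ) * ∑ m, (w1 (c m) - μ1)|
      ≤ Real.sqrt (θ / N) * μ := by
    have hc : ∑ a, p a * (w1 a - μ1) = 0 := by
      simp only [mul_sub, Finset.sum_sub_distrib, ← Finset.sum_mul, hp.2]
      simp [hμ1]
    have hsm := second_moment hp (fun a => w1 a - μ1) hc N
    have hvar : ∑ a, p a * (w1 a - μ1) ^ 2 ≤ θ * μ * μ := by
      have e : ∑ a, p a * (w1 a - μ1) ^ 2 = ∑ a, p a * w1 a ^ 2 - μ1 ^ 2 := by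
        have : ∀ a, p a * (w1 a - μ1) ^ 2
          = p a * w1 a ^ 2 - 2 * μ1 * (p a * w1 a) + p a * μ1 ^ 2 := fun a => by ring
        simp only [this, Finset.sum_add_distrib, Finset.sum_sub_distrib, ← Finset.mul_sum,
          ← Finset.sum_mul, hp.2, ← hμ1]
        ring
      have e2 : ∑ a, p a * w1 a ^ 2 ≤ θ * μ * μ1 := by
        rw [hμ1, Finset.mul_sum]
        refine Finset.sum_le_sum fun a _ => ?_
        have := mul_le_mul_of_nonneg_left (hw1θ a) (mul_nonneg (hp.1 a) (hw10 a))
        nlinarith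
      have e3 : θ * μ * μ1 ≤ θ * μ * μ :=
        mul_le_mul_of_nonneg_left (by linarith) (by positivity)
      nlinarith [sq_nonneg μ1]
    have hcs : (∑ c, prodPMF p N c * |(1 / N : ℝ) * ∑ m, (w1 (c m) - μ1)|) ^ 2
        ≤ (∑ c, prodPMF p N c) *
          ∑ c, prodPMF p N c * ((1 / N : ℝ) * ∑ m, (w1 (c m) - μ1)) ^ 2 := by
      apply Finset.sum_sq_le_sum_mul_sum_of_sq_le_mul
      · intro c _; exact hP.1 c
      · intro c _; exact mul_nonneg (hP.1 c) (sq_nonneg _)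
      · intro c _; apply le_of_eq; rw [mul_pow, sq_abs]; ring
    have hq : ∑ c, prodPMF p N c * ((1 / N : ℝ) * ∑ m, (w1 (c m) - μ1)) ^ 2
        ≤ (Real.sqrt (θ / N) * μ) ^ 2 := by
      have : ∀ c : Fin N → A, prodPMF p N c * ((1 / N : ℝ) * ∑ m, (w1 (c m) - μ1)) ^ 2
        = (1 / N : ℝ) ^ 2 * (prodPMF p N c * (∑ m, (w1 (c m) - μ1)) ^ 2) := fun c => by ring
      simp only [this, ← Finset.mul_sum]
      rw [hsm, mul_pow, Real.sq_sqrt (by positivity)]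
      calc (1 / N : ℝ) ^ 2 * (N * ∑ x, p x * (w1 x - μ1) ^ 2)
          = (∑ x, p x * (w1 x - μ1) ^ 2) / N := by field_simp
        _ ≤ θ * μ * μ / N := by gcongr
        _ = _ := by ring
    rw [hP.2, one_mul] at hcs
    exact (le_abs_self _).trans (abs_le_of_sq_le_sq (hcs.trans hq) (by positivity))
  calc _ ≤ ∑ c, prodPMF p N c * (|(1 / N : ℝ) * ∑ m, (w1 (c m) - μ1)| +
          ((1 / N : ℝ) * ∑ m, w2 (c m) + μ2)) :=
        Finset.sum_le_sum fun c _ => mul_le_mul_of_nonneg_left (step c) (hP.1 c)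
    _ = ∑ c, prodPMF p N c * |(1 / N : ℝ) * ∑ m, (w1 (c m) - μ1)| + 2 * μ2 := by
        rw [← hE2, ← Finset.sum_add_distrib]
        exact Finset.sum_congr rfl fun c _ => by ring
    _ ≤ _ := by linarith

lemma tendsto_two_rpow (κ : ℝ) (hκ : κ < 0) :
    Tendsto (fun n : ℕ => (2 : ℝ) ^ ((n : ℝ) * κ)) atTop (nhds 0) := by
  have : (fun n : ℕ => (2 : ℝ) ^ ((n : ℝ) * κ)) = fun n : ℕ => ((2 : ℝ) ^ κ) ^ n := by
    ext n
    rw [mul_comm, Real.rpow_mul (by norm_num), Real.rpow_natCast]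
  rw [this]
  exact tendsto_pow_atTop_nhds_zero_of_lt_one (by positivity)
    (Real.rpow_lt_one_of_one_lt_of_neg (by norm_num) hκ)

lemma joint_isPMF {U Y : Type} [Fintype U] [Fintype Y] {pU : U → ℝ} (hU : IsPMF pU)
    {W : U → Y → ℝ} (hW : ∀ u, IsPMF (W u)) :
    IsPMF (fun z : U × Y => pU z.1 * W z.1 z.2) := by
  refine ⟨fun z => mul_nonneg (hU.1 _) ((hW _).1 _), ?_⟩
  rw [Fintype.sum_prod_type]
  simp only [← Finset.mul_sum, (hW _).2, mul_one, hU.2]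

lemma out_isPMF {U Y : Type} [Fintype U] [Fintype Y] {pU : U → ℝ} (hU : IsPMF pU)
    {W : U → Y → ℝ} (hW : ∀ u, IsPMF (W u)) :
    IsPMF (fun y => ∑ u, pU u * W u y) := by
  refine ⟨fun y => Finset.sum_nonneg fun u _ => mul_nonneg (hU.1 _) ((hW _).1 _), ?_⟩
  rw [Finset.sum_comm]
  simp only [← Finset.mul_sum, (hW _).2, mul_one, hU.2]

lemma out_pos {U Y : Type} [Fintype U] [Fintype Y] {pU : U → ℝ} (hU : IsPMF pU)
    {W : U → Y → ℝ} (hW : ∀ u, IsPMF (W u)) {u : U} {y : Y} (h : pU u * W u y ≠ 0) :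
    0 < pU u ∧ 0 < W u y ∧ 0 < ∑ u, pU u * W u y := by
  have h1 : 0 < pU u := lt_of_le_of_ne (hU.1 u) (Ne.symm (left_ne_zero_of_mul h))
  have h2 : 0 < W u y := lt_of_le_of_ne ((hW u).1 y) (Ne.symm (right_ne_zero_of_mul h))
  refine ⟨h1, h2, ?_⟩
  refine lt_of_lt_of_le (mul_pos h1 h2) ?_
  exact Finset.single_le_sum (f := fun u => pU u * W u y)
    (fun u _ => mul_nonneg (hU.1 _) ((hW _).1 _)) (Finset.mem_univ u)

lemma MI_eq {U Y : Type} [Fintype U] [Fintype Y] {pU : U → ℝ} (hU : IsPMF pU)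
    {W : U → Y → ℝ} (hW : ∀ u, IsPMF (W u)) :
    MI2 (fun z : U × Y => pU z.1 * W z.1 z.2) =
      ∑ z : U × Y, pU z.1 * W z.1 z.2 * Real.logb 2 (W z.1 z.2 / ∑ u, pU u * W u z.2) := by
  have hF : margFst (fun z : U × Y => pU z.1 * W z.1 z.2) = pU := by
    ext u
    simp only [margFst, ← Finset.mul_sum, (hW _).2, mul_one]
  have hS : margSnd (fun z : U × Y => pU z.1 * W z.1 z.2) = fun y => ∑ u, pU u * W u y := rfl
  have e1 : H2 pU = -∑ z : U × Y, pU z.1 * W z.1 z.2 * Real.logb 2 (pU z.1) := by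
    rw [H2, Fintype.sum_prod_type]
    congr 1
    refine Finset.sum_congr rfl fun u _ => ?_
    dsimp only
    rw [← Finset.sum_mul, ← Finset.mul_sum, (hW u).2, mul_one]
  have e2 : H2 (fun y => ∑ u, pU u * W u y) =
      -∑ z : U × Y, pU z.1 * W z.1 z.2 * Real.logb 2 (∑ u, pU u * W u z.2) := by
    rw [H2, Fintype.sum_prod_type_right]
    congr 1
    refine Finset.sum_congr rfl fun y _ => ?_
    dsimp only
    rw [← Finset.sum_mul]
  rw [MI2, hF, hS, e1, e2, H2]
  rw [sub_neg_eq_add, ← sub_eq_zero, ← Finset.sum_neg_distrib, ← Finset.sum_neg_distrib,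
    ← Finset.sum_add_distrib, ← Finset.sum_add_distrib, ← Finset.sum_sub_distrib]
  refine Finset.sum_eq_zero fun z _ => ?_
  by_cases h : pU z.1 * W z.1 z.2 = 0
  · simp [h]
  · obtain ⟨h1, h2, h3⟩ := out_pos hU hW h
    rw [Real.logb_mul h1.ne' h2.ne', Real.logb_div h2.ne' h3.ne']
    ring

lemma out_n {U Y : Type} [Fintype U] [Fintype Y] (pU : U → ℝ) (W : U → Y → ℝ) (n : ℕ)
    (y : Fin n → Y) :
    prodPMF (fun y => ∑ u, pU u * W u y) n y
      = ∑ u, prodPMF pU n u * ∏ t, W (u t) (y t) := by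
  have := sum_prod_pi (fun (t : Fin n) (u : U) => pU u * W u (y t))
  rw [prodPMF, ← this]
  simp only [Finset.prod_mul_distrib, prodPMF]

lemma chan_n {U Y : Type} [Fintype U] [Fintype Y]
    {W : U → Y → ℝ} (hW : ∀ u, IsPMF (W u)) {n : ℕ} (u : Fin n → U) :
    IsPMF (fun y : Fin n → Y => ∏ t, W (u t) (y t)) := by
  refine ⟨fun y => Finset.prod_nonneg fun t _ => (hW _).1 _, ?_⟩
  rw [sum_prod_pi (fun t y => W (u t) y)]
  simp [(hW _).2]

lemma dens_n {U Y : Type} [Fintype U] [Fintype Y] {pU : U → ℝ} (hU : IsPMF pU)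
    {W : U → Y → ℝ} (hW : ∀ u, IsPMF (W u)) {n : ℕ} (z : Fin n → U × Y)
    (hz : prodPMF (fun z : U × Y => pU z.1 * W z.1 z.2) n z ≠ 0) (γ : ℝ) :
    (2 : ℝ) ^ ((n : ℝ) * γ) * prodPMF (fun y => ∑ u, pU u * W u y) n (fun t => (z t).2)
        < ∏ t, W (z t).1 (z t).2 ↔
      n * γ < ∑ t, Real.logb 2 (W (z t).1 (z t).2 / ∑ u, pU u * W u (z t).2) := by
  have hz' : ∀ t, pU (z t).1 * W (z t).1 (z t).2 ≠ 0 := fun t =>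
    (Finset.prod_ne_zero_iff.1 hz) t (Finset.mem_univ t)
  have hq : 0 < prodPMF (fun y => ∑ u, pU u * W u y) n (fun t => (z t).2) :=
    Finset.prod_pos fun t _ => (out_pos hU hW (hz' t)).2.2
  have e : ∏ t, W (z t).1 (z t).2 =
      (2 : ℝ) ^ (∑ t, Real.logb 2 (W (z t).1 (z t).2 / ∑ u, pU u * W u (z t).2)) *
      prodPMF (fun y => ∑ u, pU u * W u y) n (fun t => (z t).2) := by
    rw [Real.rpow_sum_of_pos (by norm_num), prodPMF, ← Finset.prod_mul_distrib]
    refine Finset.prod_congr rfl fun t _ => ?_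
    obtain ⟨h1, h2, h3⟩ := out_pos hU hW (hz' t)
    rw [Real.rpow_logb (by norm_num) (by norm_num) (by positivity)]
    field_simp
  rw [e, mul_lt_mul_iff_left₀ hq, Real.rpow_lt_rpow_left_iff (by norm_num)]

lemma tail_gen {U Y : Type} [Fintype U] [Fintype Y] {pU : U → ℝ} (hU : IsPMF pU)
    {W : U → Y → ℝ} (hW : ∀ u, IsPMF (W u)) (I δ : ℝ)
    (hI : I = MI2 (fun z : U × Y => pU z.1 * W z.1 z.2)) (hδ : 0 < δ) :
    ∃ a : ℕ → ℝ, Tendsto a atTop (nhds 0) ∧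
      ∀ (n : ℕ) (S : (Fin n → U) → (Fin n → Y) → Prop),
      (∀ z : Fin n → U × Y, prodPMF (fun z : U × Y => pU z.1 * W z.1 z.2) n z ≠ 0 →
        S (fun t => (z t).1) (fun t => (z t).2) →
        n * δ ≤ |∑ t, Real.logb 2 (W (z t).1 (z t).2 / ∑ u, pU u * W u (z t).2) - n * I|) →
      ∑ u, prodPMF pU n u * ∑ y, (if S u y then ∏ t, W (u t) (y t) else 0) ≤ a n := by
  have hj := joint_isPMF hU hW
  have hc : ∑ z : U × Y, (pU z.1 * W z.1 z.2) *
      (Real.logb 2 (W z.1 z.2 / ∑ u, pU u * W u z.2) - I) = 0 := by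
    simp only [mul_sub, Finset.sum_sub_distrib, ← Finset.sum_mul]
    rw [← MI_eq hU hW, hj.2, hI]
    ring
  obtain ⟨a, ha, hb⟩ := cheby hj _ hc δ hδ
  refine ⟨a, ha, fun n S hS => ?_⟩
  refine le_trans (le_of_eq ?_) (hb n (fun z =>
    prodPMF (fun z : U × Y => pU z.1 * W z.1 z.2) n z ≠ 0 ∧
      S (fun t => (z t).1) (fun t => (z t).2)) ?_)
  · simp only [Finset.mul_sum]
    rw [← Fintype.sum_prod_type'
      (f := fun u y => prodPMF pU n u * (if S u y then ∏ t, W (u t) (y t) else 0))]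
    symm
    refine Fintype.sum_equiv (Equiv.arrowProdEquivProdArrow (Fin n) (fun _ => U) (fun _ => Y))
      _ _ (fun z => ?_)
    show _ =
      prodPMF pU n (fun t => (z t).1) *
        (if S (fun t => (z t).1) (fun t => (z t).2) then ∏ t, W (z t).1 (z t).2 else 0)
    have e : prodPMF (fun z : U × Y => pU z.1 * W z.1 z.2) n z =
      prodPMF pU n (fun t => (z t).1) * ∏ t, W (z t).1 (z t).2 := by
      simp only [prodPMF, Finset.prod_mul_distrib]
    by_cases h : prodPMF (fun z : U × Y => pU z.1 * W z.1 z.2) n z = 0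
    · simp only [h, zero_mul]
      rw [e] at h
      split_ifs
      · exact h.symm
      · simp
    · by_cases hS : S (fun t => (z t).1) (fun t => (z t).2)
      · rw [if_pos ⟨h, hS⟩, if_pos hS, e, mul_one]
      · rw [if_neg (fun h => hS h.2), if_neg hS]; simp
  · intro z hz
    have := hS z hz.1 hz.2
    simpa [Finset.sum_sub_distrib] using this

lemma soft_n {U Y : Type} [Fintype U] [Fintype Y] {pU : U → ℝ} (hU : IsPMF pU)
    {W : U → Y → ℝ} (hW : ∀ u, IsPMF (W u)) (R : ℝ)
    (hI : MI2 (fun z : U × Y => pU z.1 * W z.1 z.2) < R) :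
    ∃ a : ℕ → ℝ, Tendsto a atTop (nhds 0) ∧ ∀ n N : ℕ, (2 : ℝ) ^ ((n : ℝ) * R) ≤ N →
      ∑ c, prodPMF (prodPMF pU n) N c *
        tvDist (fun y : Fin n → Y => (1 / N : ℝ) * ∑ m, ∏ t, W (c m t) (y t))
          (prodPMF (fun y => ∑ u, pU u * W u y) n) ≤ a n := by
  set I := MI2 (fun z : U × Y => pU z.1 * W z.1 z.2) with hIdef
  set γ := (I + R) / 2 with hγ
  obtain ⟨a, ha, hb⟩ := tail_gen hU hW I (γ - I) hIdef (by rw [hγ]; linarith)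
  refine ⟨fun n => (1 / 2) * (2 * a n + Real.sqrt ((2 : ℝ) ^ ((n : ℝ) * (γ - R)))), ?_, ?_⟩
  · have h1 := (tendsto_two_rpow (γ - R) (by rw [hγ]; linarith)).sqrt
    simpa using ((ha.const_mul 2).add h1).const_mul (1 / 2 : ℝ)
  intro n N hN
  have hpos : (0 : ℝ) < (2 : ℝ) ^ ((n : ℝ) * R) := by positivity
  have hN0 : (0 : ℝ) < N := hpos.trans_le hN
  have hN1 : 1 ≤ N := by exact_mod_cast hN0
  have hPU := prodPMF_isPMF hU n
  set q := prodPMF (fun y => ∑ u, pU u * W u y) n with hq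
  have hqP : IsPMF q := prodPMF_isPMF (out_isPMF hU hW) n
  set θ : ℝ := (2 : ℝ) ^ ((n : ℝ) * γ) with hθ
  have key := fun y : Fin n → Y => soft_point hPU (fun u => ∏ t, W (u t) (y t))
    (fun u => (chan_n hW u).1 y) θ (by positivity) N hN1 (q y) (out_n pU W n y)
  have hs := Finset.sum_le_sum (s := Finset.univ) (fun y _ => key y)
  have hb' := hb n (fun u y => θ * q y < ∏ t, W (u t) (y t)) (by
    intro z hz hS
    have := (dens_n hU hW z hz γ).1 hS
    refine le_trans ?_ (le_abs_self _)
    linarith)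
  have hsq : Real.sqrt (θ / N) ≤ Real.sqrt ((2 : ℝ) ^ ((n : ℝ) * (γ - R))) := by
    apply Real.sqrt_le_sqrt
    rw [mul_sub, Real.rpow_sub (by norm_num)]
    gcongr
  rw [Finset.sum_add_distrib, ← Finset.mul_sum, ← Finset.mul_sum, hqP.2, mul_one] at hs
  have e1 : ∑ y : Fin n → Y, ∑ u, prodPMF pU n u *
      (if θ * q y < ∏ t, W (u t) (y t) then ∏ t, W (u t) (y t) else 0) =
      ∑ u, prodPMF pU n u * ∑ y : Fin n → Y,
        (if θ * q y < ∏ t, W (u t) (y t) then ∏ t, W (u t) (y t) else 0) := by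
    rw [Finset.sum_comm]
    simp only [Finset.mul_sum]
  have e2 : ∑ c, prodPMF (prodPMF pU n) N c *
        tvDist (fun y : Fin n → Y => (1 / N : ℝ) * ∑ m, ∏ t, W (c m t) (y t)) q
      = (1 / 2) * ∑ y : Fin n → Y, ∑ c, prodPMF (prodPMF pU n) N c *
        |(1 / N : ℝ) * ∑ m, ∏ t, W (c m t) (y t) - q y| := by
    rw [Finset.sum_comm, Finset.mul_sum]
    refine Finset.sum_congr rfl fun c _ => ?_
    rw [tvDist, ← Finset.mul_sum]
    ring
  rw [e2]
  refine mul_le_mul_of_nonneg_left ?_ (by norm_num)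
  refine hs.trans ?_
  rw [e1]
  linarith

lemma rel_one {A B : Type} [Fintype A] [Fintype B] {p : A → ℝ} (hp : IsPMF p)
    {W : A → B → ℝ} (hW : ∀ a, IsPMF (W a)) (q : B → ℝ) (hq : ∀ y, q y = ∑ a, p a * W a y)
    (θ : ℝ) (hθ : 0 < θ) (N : ℕ) (hN : 1 ≤ N) :
    ∃ dec : (Fin N → A) → B → Option (Fin N), ∀ Q : B → ℝ, IsPMF Q →
      ∑ c, prodPMF p N c * ((∑ y, Q y * (if dec c y ≠ none then 1 else 0)) +
        (1 / N : ℝ) * ∑ m, ∑ y, W (c m) y * (if dec c y ≠ some m then 1 else 0))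
      ≤ ∑ a, p a * ∑ y, (if θ * q y < W a y then 0 else W a y) + 2 * (N / θ) := by
  have hP := prodPMF_isPMF hp N
  have hN0 : (0 : ℝ) < N := by exact_mod_cast hN
  have hq0 : ∀ y, 0 ≤ q y := fun y => hq y ▸
    Finset.sum_nonneg fun a _ => mul_nonneg (hp.1 a) ((hW a).1 y)
  have hqs : ∑ y, q y = 1 := by
    have := (out_isPMF hp hW).2
    simpa only [hq] using this
  set acc : A → B → ℝ := fun a y => if θ * q y < W a y then 1 else 0 with hacc
  have hacc0 : ∀ a y, 0 ≤ acc a y := fun a y => by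
    simp only [hacc]; split_ifs <;> norm_num
  have hmk : ∀ y, ∑ a, p a * acc a y ≤ 1 / θ := by
    intro y
    rcases (hq0 y).eq_or_lt with h | h
    · have h0 : ∀ a, p a * W a y = 0 := by
        have := (Finset.sum_eq_zero_iff_of_nonneg (s := Finset.univ)
          (f := fun a => p a * W a y) (fun a _ => mul_nonneg (hp.1 a) ((hW a).1 y))).1
          ((hq y).symm.trans h.symm)
        exact fun a => this a (Finset.mem_univ a)
      rw [Finset.sum_eq_zero]
      · positivity
      · intro a _
        simp only [hacc]
        split_ifs with h1
        · rw [← h, mul_zero] at h1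
          rcases mul_eq_zero.1 (h0 a) with h2 | h2
          · rw [h2, zero_mul]
          · linarith
        · simp
    · rw [le_div_iff₀ hθ]
      refine le_of_mul_le_mul_right ?_ h
      rw [one_mul, mul_assoc, Finset.sum_mul]
      conv_rhs => rw [hq y]
      refine Finset.sum_le_sum fun a _ => ?_
      rw [mul_assoc]
      refine mul_le_mul_of_nonneg_left ?_ (hp.1 a)
      simp only [hacc]
      split_ifs with h1
      · linarith
      · simpa using (hW a).1 y
  refine ⟨fun c y => if h : ∃ m, θ * q y < W (c m) y then some h.choose else none,
    fun Q hQ => ?_⟩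
  set dec : (Fin N → A) → B → Option (Fin N) :=
    fun c y => if h : ∃ m, θ * q y < W (c m) y then some h.choose else none with hdec
  have b1 : ∀ c y, (if dec c y ≠ none then (1 : ℝ) else 0) ≤ ∑ m, acc (c m) y := by
    intro c y
    by_cases h : ∃ m, θ * q y < W (c m) y
    · obtain ⟨m, hm⟩ := id h
      have h1 : acc (c m) y = 1 := if_pos hm
      have h2 := Finset.single_le_sum (f := fun m => acc (c m) y) (fun m _ => hacc0 _ _)
        (Finset.mem_univ m)
      simp only [h1] at h2
      split_ifs <;> linarith
    · have : dec c y = none := dif_neg h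
      simp only [this, ne_eq, not_true_eq_false, if_false]
      exact Finset.sum_nonneg fun m _ => hacc0 _ _
  have b2 : ∀ c m y, (if dec c y ≠ some m then (1 : ℝ) else 0) ≤
      (1 - acc (c m) y) + ∑ m' ∈ Finset.univ.erase m, acc (c m') y := by
    intro c m y
    have hs : 0 ≤ ∑ m' ∈ Finset.univ.erase m, acc (c m') y :=
      Finset.sum_nonneg fun m _ => hacc0 _ _
    by_cases hm : θ * q y < W (c m) y
    · have h1 : acc (c m) y = 1 := if_pos hm
      have h : ∃ m, θ * q y < W (c m) y := ⟨m, hm⟩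
      have hd : dec c y = some h.choose := dif_pos h
      by_cases he : h.choose = m
      · rw [hd, he, h1]; simpa using hs
      · have h2 : acc (c h.choose) y = 1 := if_pos h.choose_spec
        have h3 := Finset.single_le_sum (f := fun m => acc (c m) y) (fun m _ => hacc0 _ _)
          (Finset.mem_erase.2 ⟨he, Finset.mem_univ h.choose⟩)
        simp only [h2] at h3
        rw [h1]
        split_ifs <;> linarith
    · have h1 : acc (c m) y = 0 := if_neg hm
      rw [h1]
      split_ifs <;> linarith
  have c1 : ∑ c, prodPMF p N c * (∑ y, Q y * (if dec c y ≠ none then 1 else 0)) ≤ N / θ := by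
    calc _ ≤ ∑ c, prodPMF p N c * (∑ y, Q y * ∑ m, acc (c m) y) :=
          Finset.sum_le_sum fun c _ => mul_le_mul_of_nonneg_left
            (Finset.sum_le_sum fun y _ => mul_le_mul_of_nonneg_left (b1 c y) (hQ.1 y)) (hP.1 c)
      _ = ∑ y, Q y * ∑ m : Fin N, ∑ c, prodPMF p N c * acc (c m) y := by
          simp only [Finset.mul_sum]
          rw [Finset.sum_comm]
          refine Finset.sum_congr rfl fun y _ => ?_
          rw [Finset.sum_comm]
          refine Finset.sum_congr rfl fun m _ => Finset.sum_congr rfl fun c _ => ?_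
          ring
      _ = ∑ y, Q y * ∑ m : Fin N, ∑ a, p a * acc a y := by
          refine Finset.sum_congr rfl fun y _ => ?_
          congr 1
          exact Finset.sum_congr rfl fun m _ => exp_one hp m (fun a => acc a y)
      _ ≤ ∑ y, Q y * (N / θ) := by
          refine Finset.sum_le_sum fun y _ => mul_le_mul_of_nonneg_left ?_ (hQ.1 y)
          refine (Finset.sum_le_sum fun m _ => hmk y).trans ?_
          simp [div_eq_mul_inv]
      _ = N / θ := by rw [← Finset.sum_mul, hQ.2, one_mul]
  have c2 : ∀ m : Fin N, ∑ c, prodPMF p N c *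
      ∑ y, W (c m) y * (if dec c y ≠ some m then 1 else 0) ≤
      ∑ a, p a * ∑ y, (if θ * q y < W a y then 0 else W a y) + N / θ := by
    intro m
    calc _ ≤ ∑ c, prodPMF p N c * ∑ y, W (c m) y *
            ((1 - acc (c m) y) + ∑ m' ∈ Finset.univ.erase m, acc (c m') y) :=
          Finset.sum_le_sum fun c _ => mul_le_mul_of_nonneg_left
            (Finset.sum_le_sum fun y _ =>
              mul_le_mul_of_nonneg_left (b2 c m y) ((hW _).1 y)) (hP.1 c)
      _ = ∑ c, prodPMF p N c * (∑ y, W (c m) y * (1 - acc (c m) y)) +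
          ∑ y, ∑ m' ∈ Finset.univ.erase m,
            ∑ c, prodPMF p N c * (W (c m) y * acc (c m') y) := by
          have : ∀ y, ∑ m' ∈ Finset.univ.erase m,
            ∑ c, prodPMF p N c * (W (c m) y * acc (c m') y) =
            ∑ c, prodPMF p N c * (W (c m) y * ∑ m' ∈ Finset.univ.erase m, acc (c m') y) := by
            intro y
            rw [Finset.sum_comm]
            simp only [Finset.mul_sum]
          simp only [this]
          rw [Finset.sum_comm (s := Finset.univ (α := B)), ← Finset.sum_add_distrib]
          refine Finset.sum_congr rfl fun c _ => ?_
          rw [← Finset.mul_sum, ← mul_add, ← Finset.sum_add_distrib]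
          simp only [mul_add]
      _ ≤ _ := by
          refine add_le_add (le_of_eq ?_) ?_
          · rw [exp_one hp m (fun a => ∑ y, W a y * (1 - acc a y))]
            refine Finset.sum_congr rfl fun a _ => ?_
            congr 1
            refine Finset.sum_congr rfl fun y _ => ?_
            simp only [hacc]
            split_ifs <;> simp
          · calc _ ≤ ∑ y, ∑ m' ∈ Finset.univ.erase m, q y * (1 / θ) := by
                  refine Finset.sum_le_sum fun y _ => Finset.sum_le_sum fun m' hm' => ?_
                  rw [exp_two hp m m' (Finset.mem_erase.1 hm').1.symm (fun a => W a y)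
                    (fun a => acc a y), ← hq y]
                  exact mul_le_mul_of_nonneg_left (hmk y) (hq0 y)
              _ ≤ ∑ y, ∑ m' : Fin N, q y * (1 / θ) := by
                  refine Finset.sum_le_sum fun y _ =>
                    Finset.sum_le_sum_of_subset_of_nonneg (Finset.erase_subset _ _) ?_
                  intro m' _ _
                  exact mul_nonneg (hq0 y) (by positivity)
              _ = N / θ := by
                  rw [Finset.sum_comm]
                  simp only [← Finset.sum_mul, hqs]
                  simp [div_eq_mul_inv]
  have e : ∑ c, prodPMF p N c * ((∑ y, Q y * (if dec c y ≠ none then 1 else 0)) +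
        (1 / N : ℝ) * ∑ m, ∑ y, W (c m) y * (if dec c y ≠ some m then 1 else 0)) =
      ∑ c, prodPMF p N c * (∑ y, Q y * (if dec c y ≠ none then 1 else 0)) +
      (1 / N : ℝ) * ∑ m : Fin N, ∑ c, prodPMF p N c *
        ∑ y, W (c m) y * (if dec c y ≠ some m then 1 else 0) := by
    rw [Finset.sum_comm (s := Finset.univ (α := Fin N)), Finset.mul_sum,
      ← Finset.sum_add_distrib]
    refine Finset.sum_congr rfl fun c _ => ?_
    rw [← Finset.mul_sum]
    ring
  rw [e]
  have c3 := Finset.sum_le_sum (s := Finset.univ) (fun m _ => c2 m)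
  rw [Finset.sum_const, Finset.card_univ, Fintype.card_fin, nsmul_eq_mul] at c3
  have c4 := mul_le_mul_of_nonneg_left c3 (show (0 : ℝ) ≤ 1 / N by positivity)
  rw [← mul_assoc, one_div_mul_cancel hN0.ne', one_mul] at c4
  linarith

lemma rel_n {U Y : Type} [Fintype U] [Fintype Y] {pU : U → ℝ} (hU : IsPMF pU)
    {W : U → Y → ℝ} (hW : ∀ u, IsPMF (W u)) (R : ℝ)
    (hI : R < MI2 (fun z : U × Y => pU z.1 * W z.1 z.2)) :
    ∃ a : ℕ → ℝ, Tendsto a atTop (nhds 0) ∧ ∀ n N : ℕ, 1 ≤ N →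
      (N : ℝ) ≤ 2 * (2 : ℝ) ^ ((n : ℝ) * R) →
      ∃ dec : (Fin N → Fin n → U) → (Fin n → Y) → Option (Fin N),
      ∀ Q : (Fin n → Y) → ℝ, IsPMF Q →
      ∑ c, prodPMF (prodPMF pU n) N c * ((∑ y, Q y * (if dec c y ≠ none then 1 else 0)) +
        (1 / N : ℝ) * ∑ m, ∑ y : Fin n → Y, (∏ t, W (c m t) (y t)) *
          (if dec c y ≠ some m then 1 else 0)) ≤ a n := by
  set I := MI2 (fun z : U × Y => pU z.1 * W z.1 z.2) with hIdef
  set γ := (I + R) / 2 with hγ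
  obtain ⟨a, ha, hb⟩ := tail_gen hU hW I (I - γ) hIdef (by rw [hγ]; linarith)
  refine ⟨fun n => a n + 4 * (2 : ℝ) ^ ((n : ℝ) * (R - γ)), ?_, ?_⟩
  · have h1 := (tendsto_two_rpow (R - γ) (by rw [hγ]; linarith))
    simpa using ha.add (h1.const_mul 4)
  intro n N hN1 hN
  have hPU := prodPMF_isPMF hU n
  obtain ⟨dec, hdec⟩ := rel_one hPU (fun u => chan_n hW u)
    (prodPMF (fun y => ∑ u, pU u * W u y) n) (out_n pU W n)
    ((2 : ℝ) ^ ((n : ℝ) * γ)) (by positivity) N hN1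
  refine ⟨dec, fun Q hQ => (hdec Q hQ).trans ?_⟩
  have hb' := hb n (fun u y => ¬ ((2 : ℝ) ^ ((n : ℝ) * γ) *
      prodPMF (fun y => ∑ u, pU u * W u y) n y < ∏ t, W (u t) (y t))) (by
    intro z hz hS
    have := not_lt.1 (mt (dens_n hU hW z hz γ).2 hS)
    refine le_trans ?_ (neg_le_abs _)
    linarith)
  refine add_le_add (le_trans (le_of_eq ?_) hb') ?_
  · refine Finset.sum_congr rfl fun u _ => ?_
    congr 1
    refine Finset.sum_congr rfl fun y _ => ?_
    by_cases h : (2 : ℝ) ^ ((n : ℝ) * γ) *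
      prodPMF (fun y => ∑ u, pU u * W u y) n y < ∏ t, W (u t) (y t)
    · rw [if_pos h, if_neg (not_not.2 h)]
    · rw [if_neg h, if_pos h]
  rw [mul_sub, Real.rpow_sub (by norm_num)]
  have : (N : ℝ) / (2 : ℝ) ^ ((n : ℝ) * γ) ≤
    2 * (2 : ℝ) ^ ((n : ℝ) * R) / (2 : ℝ) ^ ((n : ℝ) * γ) := by gcongr
  calc _ ≤ 2 * (2 * (2 : ℝ) ^ ((n : ℝ) * R) / (2 : ℝ) ^ ((n : ℝ) * γ)) := by linarith
    _ = _ := by ring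

lemma exists_le_avg {A : Type} [Fintype A] {P : A → ℝ} (hP : IsPMF P) (T : A → ℝ) (r : ℝ)
    (h : ∑ c, P c * T c ≤ r) : ∃ c, T c ≤ r := by
  by_contra hcon
  push Not at hcon
  have h1 : ∑ c, P c * (T c - r) ≤ 0 := by
    simp only [mul_sub, Finset.sum_sub_distrib, ← Finset.sum_mul, hP.2]
    linarith
  have h2 : ∀ c ∈ Finset.univ, 0 ≤ P c * (T c - r) := fun c _ =>
    mul_nonneg (hP.1 c) (by linarith [hcon c])
  have h3 := (Finset.sum_eq_zero_iff_of_nonneg h2).1 (le_antisymm h1 (Finset.sum_nonneg h2))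
  have h4 : ∑ c, P c = 0 := Finset.sum_eq_zero fun c hc => by
    rcases mul_eq_zero.1 (h3 c hc) with h | h
    · exact h
    · linarith [hcon c]
  linarith [hP.2]

lemma push_marg {C : ℕ} {X : Fin C → Type} [∀ i, Fintype (X i)] {n : ℕ}
    (p : Fin n → (∀ i, X i) → ℝ) (J : Finset (Fin C))
    (F : (Fin n → (i : {i // i ∈ J}) → X i.1) → ℝ) :
    ∑ v : Fin n → ∀ i, X i, (∏ t, p t (v t)) * F (fun t => restr J (v t))
      = ∑ w, (∏ t, marg (p t) J (w t)) * F w := by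
  rw [push_prod p (restr J) F]
  simp only [marg]
  congr!

lemma marg_isPMF {C : ℕ} {X : Fin C → Type} [∀ i, Fintype (X i)]
    {p : (∀ i, X i) → ℝ} (hp : IsPMF p) (J : Finset (Fin C)) : IsPMF (marg p J) := by
  refine ⟨fun y => Finset.sum_nonneg fun x _ => ?_, ?_⟩
  · split_ifs
    exacts [hp.1 x, le_rfl]
  · simp only [marg]
    rw [Finset.sum_comm]
    simp [hp.2]

lemma activeMarg_eq {C : ℕ} {X : Fin C → Type} [∀ i, Fintype (X i)] {n N : ℕ} {U : Type}
    (k : U → (∀ i, X i) → ℝ) (c : Fin N → Fin n → U) (J : Finset (Fin C)) :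
    activeMarg (fun m (v : Fin n → ∀ i, X i) => ∏ t, k (c m t) (v t)) J =
      fun w => (1 / N : ℝ) * ∑ m, ∏ t, marg (k (c m t)) J (w t) := by
  ext w
  unfold activeMarg
  congr 1
  refine Finset.sum_congr rfl fun m _ => ?_
  have := push_marg (fun t => k (c m t)) J (fun w' => if w' = w then 1 else 0)
  simp only [mul_ite, mul_one, mul_zero, Finset.sum_ite_eq', Finset.mem_univ, if_true] at this
  rw [← this]

/-- **Theorem 1 (Erasure jamming achievability).**
If the feasible set of optimization (A) is nonempty and `0 < ε < K̄(P^inn_X, Z)`,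
then the rate `R = K̄(P^inn_X, Z) − ε` is achievable under erasure jamming. -/
theorem erasure_jamming_achievability
    {C : ℕ} (X : Fin C → Type) [∀ i, Fintype (X i)]
    (pinn : (∀ i, X i) → ℝ) (hpinn : IsPMF pinn)
    (Z : ℕ) (hZ : 2 * Z < C)
    (hfeas : (KbarSet X pinn Z).Nonempty)
    (ε : ℝ) (hε : 0 < ε) (hεK : ε < Kbar X pinn Z) :
    ∃ (N : ℕ → ℕ)
      (enc : (n : ℕ) → Fin (N n) → (Fin n → ∀ i, X i) → ℝ)
      (dec : (n : ℕ) → (J : Finset (Fin C)) →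
        (Fin n → (i : {i // i ∈ Jᶜ}) → X i.1) → Option (Fin (N n))),
      -- each blocklength-n code is a bona fide stochastic code of rate at least R
      (∀ n, 1 ≤ n → (∀ m, IsPMF (enc n m)) ∧
        Kbar X pinn Z - ε ≤ Real.logb 2 (N n) / n) ∧
      -- stealth: for every J ∈ 𝔍 the active marginal tends to the innocent marginal
      (∀ J ∈ Jsets C Z,
        Tendsto (fun n => tvDist (activeMarg (enc n) J) (prodPMF (marg pinn J) n))
          atTop (nhds 0)) ∧
      -- reliability: the erasure error probability tends to 0
      Tendsto (fun n => erasureErr pinn Z (enc n) (dec n)) atTop (nhds 0) := by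
  have hlt0 : Kbar X pinn Z - ε < sSup (KbarSet X pinn Z) := by
    change Kbar X pinn Z - ε < Kbar X pinn Z
    linarith
  obtain ⟨r, ⟨U, inst, pU, k, ⟨hU, hk, hmarg, hlt⟩, rfl⟩, hr⟩ :=
    exists_lt_of_lt_csSup hfeas hlt0
  obtain ⟨R, hR1, hR2⟩ := exists_between (max_lt hlt hr)
  obtain ⟨hR1a, hR1b⟩ := max_lt_iff.1 hR1
  have hR0 : 0 < R := by linarith
  have hWJ : ∀ J u, IsPMF (marg (k u) J) := fun J u => marg_isPMF (hk u) J
  have hq : ∀ J ∈ Jsets C Z, (fun y => ∑ u, pU u * marg (k u) J y) = marg pinn J := by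
    intro J hJ
    rw [← hmarg J hJ]
    ext y
    simp only [marg, Finset.mul_sum]
    rw [Finset.sum_comm]
    refine Finset.sum_congr rfl fun x _ => ?_
    split_ifs <;> simp
  have soft : ∀ J ∈ Jsets C Z, _ := fun J hJ => soft_n hU (hWJ J) R
    (lt_of_le_of_lt (Finset.le_sup' (fun J => MI2 (jointUXJ pU k J)) hJ) hR1a)
  have rel : ∀ J ∈ Jsets C Z, _ := fun J hJ => rel_n hU (hWJ Jᶜ) R
    (lt_of_lt_of_le hR2 (Finset.inf'_le (fun J => MI2 (jointUXJ pU k Jᶜ)) hJ))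
  choose! a ha1 ha2 using soft
  choose! b hb1 hb2 using rel
  set N : ℕ → ℕ := fun n => ⌈(2 : ℝ) ^ ((n : ℝ) * R)⌉₊ with hN
  have hNge : ∀ n : ℕ, (2 : ℝ) ^ ((n : ℝ) * R) ≤ N n := fun n => Nat.le_ceil _
  have hone : ∀ n : ℕ, 1 ≤ (2 : ℝ) ^ ((n : ℝ) * R) := fun n =>
    Real.one_le_rpow (by norm_num) (by positivity)
  have hN1 : ∀ n, 1 ≤ N n := fun n => by exact_mod_cast (hone n).trans (hNge n)
  have hNle : ∀ n : ℕ, (N n : ℝ) ≤ 2 * (2 : ℝ) ^ ((n : ℝ) * R) := fun n => by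
    have := Nat.ceil_lt_add_one (show 0 ≤ (2 : ℝ) ^ ((n : ℝ) * R) by positivity)
    have h2 := hone n
    simp only [hN]
    linarith
  have rel2 : ∀ n, ∀ J ∈ Jsets C Z, _ := fun n J hJ => hb2 J hJ n (N n) (hN1 n) (hNle n)
  choose! dec0 hdec0 using rel2
  set tvc : (n : ℕ) → (Fin (N n) → Fin n → U) → Finset (Fin C) → ℝ := fun n c J =>
    tvDist (activeMarg (fun m (v : Fin n → ∀ i, X i) => ∏ t, k (c m t) (v t)) J)
      (prodPMF (marg pinn J) n) with htvc
  set errc : (n : ℕ) → (Fin (N n) → Fin n → U) → Finset (Fin C) → ℝ := fun n c J =>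
    (∑ v : Fin n → ∀ i, X i, prodPMF pinn n v *
      (if dec0 n J c (fun t => restr Jᶜ (v t)) ≠ none then 1 else 0)) +
    (1 / ((N n : ℕ) : ℝ)) * ∑ m, ∑ v : Fin n → ∀ i, X i, (∏ t, k (c m t) (v t)) *
      (if dec0 n J c (fun t => restr Jᶜ (v t)) ≠ some m then 1 else 0) with herrc
  have htv0 : ∀ n c J, 0 ≤ tvc n c J := fun n c J =>
    mul_nonneg (by norm_num) (Finset.sum_nonneg fun _ _ => abs_nonneg _)
  have herr0 : ∀ n c J, 0 ≤ errc n c J := by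
    intro n c J
    have hi : ∀ (P : Prop) [Decidable P], (0 : ℝ) ≤ if P then 1 else 0 := fun P _ => by
      split_ifs <;> norm_num
    refine add_nonneg (Finset.sum_nonneg fun v _ =>
      mul_nonneg ((prodPMF_isPMF hpinn n).1 v) (hi _)) (mul_nonneg (by positivity)
      (Finset.sum_nonneg fun m _ => Finset.sum_nonneg fun v _ =>
        mul_nonneg (Finset.prod_nonneg fun t _ => (hk _).1 _) (hi _)))
  have hcode : ∀ n, ∃ c : Fin (N n) → Fin n → U,
      ∑ J ∈ Jsets C Z, (tvc n c J + errc n c J) ≤ ∑ J ∈ Jsets C Z, (a J n + b J n) := by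
    intro n
    have hPU := prodPMF_isPMF (prodPMF_isPMF hU n) (N n)
    apply exists_le_avg hPU
    simp only [Finset.mul_sum]
    rw [Finset.sum_comm]
    refine Finset.sum_le_sum fun J hJ => ?_
    simp only [mul_add, Finset.sum_add_distrib]
    refine add_le_add ?_ ?_
    · have h1 := ha2 J hJ n (N n) (hNge n)
      rw [hq J hJ] at h1
      simp only [htvc, activeMarg_eq]
      exact h1
    · have h1 := hdec0 n J hJ (prodPMF (marg pinn Jᶜ) n)
        (prodPMF_isPMF (marg_isPMF hpinn Jᶜ) n)
      refine le_trans (le_of_eq ?_) h1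
      refine Finset.sum_congr rfl fun c _ => ?_
      congr 1
      simp only [herrc]
      congr 1
      · exact push_marg (fun _ => pinn) Jᶜ
          (fun y => if dec0 n J c y ≠ none then 1 else 0)
      · congr 1
        refine Finset.sum_congr rfl fun m _ => ?_
        exact push_marg (fun t => k (c m t)) Jᶜ
          (fun y => if dec0 n J c y ≠ some m then 1 else 0)
  choose c hc using hcode
  have hlim : Tendsto (fun n => ∑ J ∈ Jsets C Z, (a J n + b J n)) atTop (nhds 0) := by
    have := tendsto_finsetSum (Jsets C Z)
      (fun J hJ => (ha1 J hJ).add (hb1 J hJ))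
    simpa using this
  have hpt : ∀ n, ∀ J ∈ Jsets C Z, tvc n (c n) J + errc n (c n) J ≤
      ∑ J ∈ Jsets C Z, (a J n + b J n) := fun n J hJ =>
    (Finset.single_le_sum (f := fun J => tvc n (c n) J + errc n (c n) J)
      (fun J _ => add_nonneg (htv0 _ _ _) (herr0 _ _ _)) hJ).trans (hc n)
  refine ⟨N, fun n m v => ∏ t, k (c n m t) (v t), fun n J y => dec0 n J (c n) y, ?_, ?_, ?_⟩
  · intro n hn
    refine ⟨fun m => chan_n hk (c n m), ?_⟩
    have hn0 : (0 : ℝ) < n := by exact_mod_cast hn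
    rw [le_div_iff₀ hn0]
    have h1 : (n : ℝ) * R ≤ Real.logb 2 (N n) := by
      rw [Real.le_logb_iff_rpow_le (by norm_num) (by exact_mod_cast hN1 n)]
      exact hNge n
    nlinarith
  · intro J hJ
    refine squeeze_zero (fun n => htv0 n (c n) J) (fun n => ?_) hlim
    have := hpt n J hJ
    have := herr0 n (c n) J
    show tvc n (c n) J ≤ _
    linarith
  · refine squeeze_zero (fun n => ?_) (fun n => ?_) hlim
    · obtain ⟨J, hJ⟩ := Jsets_nonempty C Z
      exact (herr0 n (c n) J).trans (Finset.le_sup' (fun J => errc n (c n) J) hJ)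
    · refine Finset.sup'_le _ _ fun J hJ => ?_
      have := hpt n J hJ
      have := htv0 n (c n) J
      show errc n (c n) J ≤ _
      linarith

end
end

section
/- Cardinality bound: Let (𝒰, P_U, P_{X|U}) with 𝒰 finite be feasible for optimization (A). Then there exists a finite set 𝒰' with |𝒰'| ≤ |𝒳| + 2|𝔍| − 1, a PMF P_{U'} on 𝒰', and a channel P_{X|U'} such that (𝒰', P_{U'}, P_{X|U'}) is also feasible for (A), the induced marginal distribution of X on 𝒳 is the same as that induced by (P_U, P_{X|U}), and for every J ∈ 𝔍 one has I(U'; X_J) = I(U; X_J) and I(U'; X_{J^c}) = I(U; X_{J^c}); in particular both triples yield the same objective value min_{J∈𝔍} I(·; X_{J^c}). -/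
open scoped BigOperators Classical
open Filter

noncomputable section

lemma aux_marg_pmf {C : ℕ} {X : Fin C → Type} [∀ i, Fintype (X i)]
    (p : (∀ i, X i) → ℝ) (J : Finset (Fin C)) : ∑ y, marg p J y = ∑ x, p x := by
  unfold marg
  rw [Finset.sum_comm]
  refine Finset.sum_congr rfl fun x _ => ?_
  simp

lemma aux_marg_mix {C : ℕ} {X : Fin C → Type} [∀ i, Fintype (X i)] {U : Type} [Fintype U]
    (pU : U → ℝ) (k : U → (∀ i, X i) → ℝ) (J : Finset (Fin C)) :
    margSnd (jointUXJ pU k J) = marg (fun x => ∑ u, pU u * k u x) J := by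
  funext y
  simp only [margSnd, jointUXJ, marg, Finset.mul_sum]
  rw [Finset.sum_comm]
  refine Finset.sum_congr rfl fun x _ => ?_
  split_ifs <;> simp

lemma aux_MI {C : ℕ} {X : Fin C → Type} [∀ i, Fintype (X i)] {U : Type} [Fintype U]
    (pU : U → ℝ) (k : U → (∀ i, X i) → ℝ) (hk : ∀ u, IsPMF (k u)) (J : Finset (Fin C)) :
    MI2 (jointUXJ pU k J) =
      H2 (marg (fun x => ∑ u, pU u * k u x) J) - ∑ u, pU u * H2 (marg (k u) J) := by
  have h1 : margFst (jointUXJ pU k J) = pU := by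
    funext u
    simp only [margFst, jointUXJ]
    rw [← Finset.mul_sum, aux_marg_pmf, (hk u).2, mul_one]
  have h2 : H2 (jointUXJ pU k J) = H2 pU + ∑ u, pU u * H2 (marg (k u) J) := by
    simp only [H2, jointUXJ]
    rw [Fintype.sum_prod_type, ← Finset.sum_neg_distrib, ← Finset.sum_neg_distrib,
      ← Finset.sum_add_distrib]
    refine Finset.sum_congr rfl fun u _ => ?_
    have h3 : ∀ y, pU u * marg (k u) J y * Real.logb 2 (pU u * marg (k u) J y)
        = (pU u * Real.logb 2 (pU u)) * marg (k u) J y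
          + pU u * (marg (k u) J y * Real.logb 2 (marg (k u) J y)) := by
      intro y
      by_cases ha : pU u = 0
      · simp [ha]
      by_cases hb : marg (k u) J y = 0
      · simp [hb]
      rw [Real.logb_mul ha hb]; ring
    simp only [h3]
    rw [Finset.sum_add_distrib, ← Finset.mul_sum, ← Finset.mul_sum, aux_marg_pmf, (hk u).2]
    ring
  rw [MI2, h1, h2, aux_marg_mix]
  ring

lemma aux_H_empty {C : ℕ} {X : Fin C → Type} [∀ i, Fintype (X i)]
    (p : (∀ i, X i) → ℝ) (hp : IsPMF p) : H2 (marg p ∅) = 0 := by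
  have : ∀ y, marg p ∅ y = 1 := by
    intro y
    rw [← hp.2]
    unfold marg
    refine Finset.sum_congr rfl fun x _ => ?_
    rw [if_pos]
    funext i
    exact absurd i.2 (Finset.notMem_empty _)
  simp [H2, this]

/-- **Cardinality bound.** Any feasible triple for optimization (A) can be replaced
by a feasible triple whose auxiliary alphabet has size at most `|𝒳| + 2|𝔍| − 1`,
preserving the marginal of `X`, all the mutual informations `I(U; X_J)` and
`I(U; X_{J^c})` for `J ∈ 𝔍`, and in particular the objective value. -/
theorem cardinality_bound
    {C : ℕ} (X : Fin C → Type) [∀ i, Fintype (X i)]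
    (pinn : (∀ i, X i) → ℝ) (Z : ℕ) (hZ : 2 * Z < C)
    (U : Type) [Fintype U] (pU : U → ℝ) (k : U → (∀ i, X i) → ℝ)
    (hfeas : FeasibleA X pinn Z U pU k) :
    ∃ (U' : Type) (inst : Fintype U') (pU' : U' → ℝ) (k' : U' → (∀ i, X i) → ℝ),
      Fintype.card U' ≤ Fintype.card (∀ i, X i) + 2 * (Jsets C Z).card - 1 ∧
      @FeasibleA C X _ pinn Z U' inst pU' k' ∧
      (fun x => ∑ u', pU' u' * k' u' x) = (fun x => ∑ u, pU u * k u x) ∧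
      (∀ J ∈ Jsets C Z,
        @MI2 U' _ inst _ (@jointUXJ C X _ U' inst pU' k' J) = MI2 (jointUXJ pU k J) ∧
        @MI2 U' _ inst _ (@jointUXJ C X _ U' inst pU' k' Jᶜ) = MI2 (jointUXJ pU k Jᶜ)) ∧
      @objA C X _ U' inst pU' k' Z = objA pU k Z := by
  obtain ⟨hpU, hk, hm, hlt⟩ := hfeas
  have hUne : Nonempty U := by
    by_contra h
    rw [not_nonempty_iff] at h
    have := hpU.2
    simp at this
  obtain ⟨u0⟩ := hUne
  have hXne : Nonempty (∀ i, X i) := by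
    by_contra h
    rw [not_nonempty_iff] at h
    have := (hk u0).2
    simp at this
  obtain ⟨x0⟩ := hXne
  let A := {x : (∀ i, X i) // x ≠ x0}
  let B := {J : Finset (Fin C) // J ∈ Jsets C Z}
  let B' := {J : Finset (Fin C) // J ∈ (Jsets C Z).erase ∅}
  let v : U → ((A ⊕ (B ⊕ B')) → ℝ) := fun u =>
    Sum.elim (fun x => k u x.1)
      (Sum.elim (fun J => H2 (marg (k u) (J.1)ᶜ)) (fun J => H2 (marg (k u) J.1)))
  have hmem : (∑ u, pU u • v u) ∈ convexHull ℝ (Set.range v) :=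
    (convex_convexHull ℝ _).sum_mem (fun u _ => hpU.1 u) hpU.2
      (fun u _ => subset_convexHull ℝ _ ⟨u, rfl⟩)
  obtain ⟨ι, inst, z, w, hz, hai, hw, hw1, hws⟩ := eq_pos_convex_span_of_mem_convexHull hmem
  have hf : ∀ i, ∃ u, v u = z i := fun i => hz ⟨i, rfl⟩
  choose f hf using hf
  have hcard : Fintype.card ι ≤ Fintype.card (∀ i, X i) + 2 * (Jsets C Z).card - 1 := by
    have h1 := hai.card_le_finrank_succ
    have h2 := Submodule.finrank_le (vectorSpan ℝ (Set.range z))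
    rw [Module.finrank_fintype_fun_eq_card, Fintype.card_sum, Fintype.card_sum] at h2
    have hA : Fintype.card A = Fintype.card (∀ i, X i) - 1 := by
      simp only [A, ne_eq]
      rw [Fintype.card_subtype_compl, Fintype.card_subtype_eq]
    have hB : Fintype.card B = (Jsets C Z).card := by simp [B]
    have he : (∅ : Finset (Fin C)) ∈ Jsets C Z := by simp [Jsets]
    have hB' : Fintype.card B' = (Jsets C Z).card - 1 := by
      rw [← Finset.card_erase_of_mem he]; simp only [B', Fintype.card_coe]
    have p1 : 0 < Fintype.card (∀ i, X i) := Fintype.card_pos_iff.mpr ⟨x0⟩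
    have p2 : 0 < (Jsets C Z).card := Finset.card_pos.mpr ⟨_, he⟩
    omega
  have hco : ∀ c, ∑ i, w i * v (f i) c = ∑ u, pU u * v u c := by
    intro c
    have := congrFun hws c
    simpa [Finset.sum_apply, hf] using this
  have hmix0 : ∀ x, x ≠ x0 → ∑ i, w i * k (f i) x = ∑ u, pU u * k u x :=
    fun x hx => hco (Sum.inl ⟨x, hx⟩)
  have hmix : (fun x => ∑ i, w i * k (f i) x) = (fun x => ∑ u, pU u * k u x) := by
    funext x
    by_cases hx : x = x0
    · subst hx
      have t1 : ∑ x, ∑ i, w i * k (f i) x = 1 := by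
        rw [Finset.sum_comm]
        simp only [← Finset.mul_sum, (hk _).2, mul_one, hw1]
      have t2 : ∑ x, ∑ u, pU u * k u x = 1 := by
        rw [Finset.sum_comm]
        simp only [← Finset.mul_sum, (hk _).2, mul_one, hpU.2]
      rw [← Finset.add_sum_erase _ _ (Finset.mem_univ x)] at t1 t2
      have t3 : ∑ y ∈ Finset.univ.erase x, ∑ i, w i * k (f i) y
          = ∑ y ∈ Finset.univ.erase x, ∑ u, pU u * k u y :=
        Finset.sum_congr rfl fun y hy => hmix0 y (Finset.ne_of_mem_erase hy)
      linarith
    · exact hmix0 x hx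
  have hMI : ∀ J ∈ Jsets C Z,
      MI2 (jointUXJ w (fun i => k (f i)) J) = MI2 (jointUXJ pU k J) ∧
      MI2 (jointUXJ w (fun i => k (f i)) Jᶜ) = MI2 (jointUXJ pU k Jᶜ) := by
    intro J hJ
    rw [aux_MI _ _ (fun i => hk (f i)), aux_MI _ _ (fun i => hk (f i)), aux_MI _ _ hk,
      aux_MI _ _ hk, hmix]
    refine ⟨?_, ?_⟩
    · congr 1
      by_cases hJe : J = ∅
      · subst hJe
        simp [aux_H_empty _ (hk _)]
      · exact hco (Sum.inr (Sum.inr ⟨J, Finset.mem_erase.mpr ⟨hJe, hJ⟩⟩))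
    · congr 1
      exact hco (Sum.inr (Sum.inl ⟨J, hJ⟩))
  have hinf : (Jsets C Z).inf' (Jsets_nonempty C Z)
        (fun J => MI2 (jointUXJ w (fun i => k (f i)) Jᶜ))
      = (Jsets C Z).inf' (Jsets_nonempty C Z) (fun J => MI2 (jointUXJ pU k Jᶜ)) :=
    Finset.inf'_congr _ rfl fun J hJ => (hMI J hJ).2
  have hsup : (Jsets C Z).sup' (Jsets_nonempty C Z)
        (fun J => MI2 (jointUXJ w (fun i => k (f i)) J))
      = (Jsets C Z).sup' (Jsets_nonempty C Z) (fun J => MI2 (jointUXJ pU k J)) :=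
    Finset.sup'_congr _ rfl fun J hJ => (hMI J hJ).1
  refine ⟨ι, inst, w, fun i => k (f i), hcard, ⟨⟨fun i => (hw i).le, hw1⟩, fun i => hk _, ?_, ?_⟩,
    hmix, hMI, hinf⟩
  · rw [hmix]; exact hm
  · rw [hinf, hsup]; exact hlt

end
end

section
/- Claim 1 (codeword-count lower bound): Let P_X be a PMF on 𝒳 feasible for optimization (B), fix J ∈ 𝔍, and set δ = min_{J'∈𝔍} H(X_{J'^c}) − H(X_J) > 0. Fix 0 < ε < δ, set R = min_{J'∈𝔍} H(X_{J'^c}) − ε, and consider the random codebook of rate R and blocklength n with N = ⌈2^{nR}⌉ codewords. Let γ > 0, let p_min be the least positive value of P_{X_J}, and set η_γ = γ·log₂(1/p_min); assume ε + η_γ < δ. Then for every 𝐱_J ∈ A^{n,γ}_{X_J}, with probability at least 1 − exp(−(1/3)·n^{−2}·2^{n(δ−ε−η_γ)}) over the random codebook, |{m : 𝐱_J(m) = 𝐱_J}| ≥ (1 − n^{−1})·2^{n(δ−ε−η_γ)}. -/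
open scoped BigOperators Classical
open Filter

noncomputable section

/-- The number of occurrences `N(a; y)` of the symbol `a` in the string `y`. -/
def countOcc {α : Type} [Fintype α] {n : ℕ} (a : α) (y : Fin n → α) : ℕ :=
  (Finset.univ.filter (fun t => y t = a)).card

/-- The `γ`-strongly typical set `A^{n,γ}` with respect to the PMF `p`. -/
def typ {α : Type} [Fintype α] (p : α → ℝ) (n : ℕ) (γ : ℝ) : Finset (Fin n → α) :=
  Finset.univ.filter (fun y =>
    (∀ a, p a = 0 → countOcc a y = 0) ∧
    ∑ a, |((countOcc a y : ℝ)) / n - p a| ≤ γ)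

/-- Probability, over the random codebook of `N` i.i.d. codewords each drawn from
the `n`-fold product of `p`, of an event `E` on codebooks. -/
def cbProb {α : Type} [Fintype α] (p : α → ℝ) (n N : ℕ)
    (E : (Fin N → Fin n → α) → Prop) : ℝ :=
  ∑ cb : Fin N → Fin n → α, if E cb then ∏ m, ∏ t, p (cb m t) else 0

/-- The number of codewords of the codebook `cb` whose sub-codeword on `J` is `xJ`:
`|{m : 𝐱_J(m) = 𝐱_J}|`. -/
def matchCount {C : ℕ} {X : Fin C → Type} [∀ i, Fintype (X i)] {n N : ℕ}
    (cb : Fin N → Fin n → ∀ i, X i) (J : Finset (Fin C))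
    (xJ : Fin n → (i : {i // i ∈ J}) → X i.1) : ℕ :=
  (Finset.univ.filter (fun m => (fun t => restr J (cb m t)) = xJ)).card

/-- `|{m : 𝐱_J(m) = 𝐱_J and (𝐱_𝒢(m), 𝐲_J) ∈ 𝒞_{Ĵ^c}}|`, where `Ĵ^c = 𝒢 ∪ J`:
the number of codewords matching `xJ` on `J` for which some codeword of the codebook
agrees with it on `𝒢` and equals `yJ` on `J`. -/
def spoofCount {C : ℕ} {X : Fin C → Type} [∀ i, Fintype (X i)] {n N : ℕ}
    (cb : Fin N → Fin n → ∀ i, X i) (J G : Finset (Fin C))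
    (xJ yJ : Fin n → (i : {i // i ∈ J}) → X i.1) : ℕ :=
  (Finset.univ.filter (fun m => (fun t => restr J (cb m t)) = xJ ∧
    ∃ m', (fun t => restr G (cb m' t)) = (fun t => restr G (cb m t)) ∧
          (fun t => restr J (cb m' t)) = yJ)).card

/-- Number of messages of the random codebook of rate `R` and blocklength `n`. -/
def numMsgs (n : ℕ) (R : ℝ) : ℕ := ⌈(2 : ℝ) ^ ((n : ℝ) * R)⌉₊

lemma aux_exp_bound (s : ℝ) (hs : 0 ≤ s) : Real.exp (-s) ≤ 1 - s + s ^ 2 / 2 := by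
  have hmono : MonotoneOn (fun x : ℝ => 1 - x + x ^ 2 / 2 - Real.exp (-x)) (Set.Ici 0) := by
    apply monotoneOn_of_deriv_nonneg (convex_Ici 0)
    · fun_prop
    · fun_prop
    · intro x hx
      have h : HasDerivAt (fun x : ℝ => 1 - x + x ^ 2 / 2 - Real.exp (-x))
          (-1 + x + Real.exp (-x)) x := by
        have h1 := (((hasDerivAt_id x).const_sub 1).add
          (((hasDerivAt_id x).pow 2).div_const 2)).sub ((hasDerivAt_id x).neg.exp)
        refine h1.congr_deriv ?_
        simp
      rw [h.deriv]
      have := Real.add_one_le_exp (-x)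
      linarith
  have := hmono (Set.mem_Ici.2 le_rfl) (Set.mem_Ici.2 hs) hs
  simp at this
  linarith

lemma aux_chernoff {β : Type} [Fintype β] (w : β → ℝ) (hw : ∀ b, 0 ≤ w b) (hw1 : ∑ b, w b = 1)
    (A : β → Prop) (N : ℕ) (M θ : ℝ) (hθ0 : 0 ≤ θ) (hM0 : 0 ≤ M)
    (hM : M ≤ N * ∑ b, if A b then w b else 0) :
    1 - Real.exp (-(1 / 3) * θ ^ 2 * M) ≤
      ∑ cb : Fin N → β, if (1 - θ) * M ≤ ((Finset.univ.filter (fun m => A (cb m))).card : ℝ)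
        then ∏ m, w (cb m) else 0 := by
  set q := ∑ b, if A b then w b else 0 with hq
  have htot : ∑ cb : Fin N → β, ∏ m, w (cb m) = 1 := by
    rw [← Fintype.sum_pow, hw1, one_pow]
  set f : β → ℝ := fun b => if A b then Real.exp (-θ) else 1 with hf
  have hprod : ∀ cb : Fin N → β, ∏ m, f (cb m) =
      Real.exp (-θ * ((Finset.univ.filter (fun m => A (cb m))).card : ℝ)) := by
    intro cb
    simp only [hf]
    rw [Finset.prod_ite]
    simp only [Finset.prod_const, Finset.prod_const_one, mul_one]
    rw [← Real.exp_nat_mul]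
    ring_nf
  have hsum : ∑ b, f b * w b = 1 - q * (1 - Real.exp (-θ)) := by
    have : ∀ b, f b * w b = w b - (if A b then w b else 0) * (1 - Real.exp (-θ)) := by
      intro b
      simp only [hf]
      split_ifs <;> ring
    simp only [this, Finset.sum_sub_distrib, ← Finset.sum_mul, hw1, hq]
  have hbad : ∀ cb : Fin N → β, ∏ m, w (cb m) -
      Real.exp (θ * ((1 - θ) * M)) * ∏ m, (f (cb m) * w (cb m)) ≤
      if (1 - θ) * M ≤ ((Finset.univ.filter (fun m => A (cb m))).card : ℝ)
        then ∏ m, w (cb m) else 0 := by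
    intro cb
    have hp : 0 ≤ ∏ m, w (cb m) := Finset.prod_nonneg fun _ _ => hw _
    rw [Finset.prod_mul_distrib, hprod, ← mul_assoc, ← Real.exp_add]
    split_ifs with h
    · have := mul_nonneg (Real.exp_pos (θ * ((1 - θ) * M) + -θ * ((Finset.univ.filter (fun m => A (cb m))).card : ℝ))).le hp
      linarith
    · push Not at h
      have h1 : 1 ≤ Real.exp (θ * ((1 - θ) * M) + -θ * ((Finset.univ.filter (fun m => A (cb m))).card : ℝ)) := by
        apply Real.one_le_exp
        nlinarith
      nlinarith
  refine le_trans ?_ (Finset.sum_le_sum fun cb _ => hbad cb)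
  rw [Finset.sum_sub_distrib, htot, ← Finset.mul_sum, ← Fintype.sum_pow (fun b => f b * w b), hsum]
  have hnn : 0 ≤ 1 - q * (1 - Real.exp (-θ)) := by
    rw [← hsum]
    refine Finset.sum_nonneg fun b _ => mul_nonneg ?_ (hw b)
    simp only [hf]
    split_ifs
    · exact (Real.exp_pos _).le
    · exact zero_le_one
  have h1 : (1 - q * (1 - Real.exp (-θ))) ^ N ≤ Real.exp (-(N * q * (1 - Real.exp (-θ)))) := by
    have := pow_le_pow_left₀ hnn (Real.one_sub_le_exp_neg (q * (1 - Real.exp (-θ)))) N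
    rw [← Real.exp_nat_mul] at this
    refine this.trans (le_of_eq ?_)
    congr 1
    ring
  have h2 : Real.exp (θ * ((1 - θ) * M)) * (1 - q * (1 - Real.exp (-θ))) ^ N ≤
      Real.exp (-(1 / 3) * θ ^ 2 * M) := by
    refine (mul_le_mul_of_nonneg_left h1 (Real.exp_pos _).le).trans ?_
    rw [← Real.exp_add]
    apply Real.exp_le_exp.2
    have h3 : 0 ≤ 1 - Real.exp (-θ) := by
      have : Real.exp (-θ) ≤ 1 := Real.exp_le_one_iff.2 (by linarith)
      linarith
    have h4 := mul_le_mul_of_nonneg_right hM h3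
    have h5 := mul_le_mul_of_nonneg_left (aux_exp_bound θ hθ0) hM0
    nlinarith [mul_nonneg hM0 (sq_nonneg θ)]
  linarith

lemma aux_typ {α : Type} [Fintype α] (p : α → ℝ) (hp0 : ∀ a, 0 ≤ p a) (hp1 : ∀ a, p a ≤ 1)
    (n : ℕ) (hn : 1 ≤ n) (γ : ℝ) (pmin : ℝ) (hpos : 0 < pmin) (hle1 : pmin ≤ 1)
    (hmin : ∀ a, 0 < p a → pmin ≤ p a) (y : Fin n → α) (hy : y ∈ typ p n γ) :
    (2 : ℝ) ^ (-(n : ℝ) * (H2 p + γ * Real.logb 2 (1 / pmin))) ≤ ∏ t, p (y t) := by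
  simp only [typ, Finset.mem_filter, Finset.mem_univ, true_and] at hy
  obtain ⟨h0, hγ⟩ := hy
  have hn0 : (0 : ℝ) < n := by exact_mod_cast hn
  have hpy : ∀ t, 0 < p (y t) := by
    intro t
    refine lt_of_le_of_ne (hp0 _) fun h => ?_
    have := h0 _ h.symm
    simp only [countOcc, Finset.card_eq_zero] at this
    have h2 : t ∈ Finset.univ.filter (fun t' => y t' = y t) := by simp
    rw [this] at h2
    simp at h2
  have hprod : 0 < ∏ t, p (y t) := Finset.prod_pos fun t _ => hpy t
  rw [← Real.le_logb_iff_rpow_le (by norm_num) hprod,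
    Real.logb_prod _ _ (fun t _ => (hpy t).ne')]
  have hsum : ∑ t, Real.logb 2 (p (y t)) = ∑ a, (countOcc a y : ℝ) * Real.logb 2 (p a) := by
    rw [← Finset.sum_fiberwise Finset.univ y]
    refine Finset.sum_congr rfl fun a _ => ?_
    rw [Finset.sum_congr rfl (g := fun _ => Real.logb 2 (p a))]
    · simp [countOcc]
    · intro t ht
      rw [(Finset.mem_filter.1 ht).2]
  set L := Real.logb 2 (1 / pmin) with hL
  have hLn : L = -Real.logb 2 pmin := by rw [hL, one_div, Real.logb_inv]
  have hL0 : 0 ≤ L := Real.logb_nonneg (by norm_num) (by rw [le_div_iff₀ hpos]; linarith)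
  have hab : ∀ a, |Real.logb 2 (p a)| ≤ L := by
    intro a
    rcases (hp0 a).eq_or_lt with h | h
    · rw [← h]; simpa using hL0
    · rw [abs_of_nonpos (Real.logb_nonpos (by norm_num) (hp0 a) (hp1 a)), hLn]
      exact neg_le_neg (Real.logb_le_logb_of_le (by norm_num) hpos (hmin a h))
  have hdev : -(γ * L) ≤ ∑ a, ((countOcc a y : ℝ) / n - p a) * Real.logb 2 (p a) := by
    have h1 : |∑ a, ((countOcc a y : ℝ) / n - p a) * Real.logb 2 (p a)| ≤ γ * L := by
      refine (Finset.abs_sum_le_sum_abs _ _).trans ?_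
      refine le_trans ?_ (mul_le_mul_of_nonneg_right hγ hL0)
      rw [Finset.sum_mul]
      refine Finset.sum_le_sum fun a _ => ?_
      rw [abs_mul]
      exact mul_le_mul_of_nonneg_left (hab a) (abs_nonneg _)
    exact (abs_le.1 h1).1
  have hsplit : ∑ a, (countOcc a y : ℝ) * Real.logb 2 (p a) =
      n * (∑ a, ((countOcc a y : ℝ) / n - p a) * Real.logb 2 (p a) - H2 p) := by
    simp only [H2, sub_neg_eq_add]
    rw [← Finset.sum_add_distrib, Finset.mul_sum]
    refine Finset.sum_congr rfl fun a _ => ?_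
    field_simp
    ring
  rw [hsum, hsplit]
  nlinarith [mul_le_mul_of_nonneg_left hdev hn0.le]

lemma aux_match {α β : Type} [Fintype α] (p : α → ℝ) (r : α → β) (n : ℕ) (y : Fin n → β) :
    ∑ v : Fin n → α, (if (fun t => r (v t)) = y then ∏ t, p (v t) else 0) =
      ∏ t, ∑ x, if r x = y t then p x else 0 := by
  rw [Fintype.prod_sum]
  refine Finset.sum_congr rfl fun v _ => ?_
  split_ifs with h
  · refine Finset.prod_congr rfl fun t _ => ?_
    rw [if_pos (congrFun h t)]
  · obtain ⟨t, ht⟩ : ∃ t, r (v t) ≠ y t := by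
      by_contra hc
      push Not at hc
      exact h (funext hc)
    exact (Finset.prod_eq_zero (Finset.mem_univ t) (if_neg ht)).symm

/-- **Claim 1 (codeword-count lower bound).** For a B-feasible `P_X`, `J ∈ 𝔍`,
`δ = min_{J'∈𝔍} H(X_{J'^c}) − H(X_J)`, `0 < ε < δ`, rate
`R = min_{J'∈𝔍} H(X_{J'^c}) − ε`, `η_γ = γ·log₂(1/p_min)` with `ε + η_γ < δ`:
for every `𝐱_J ∈ A^{n,γ}_{X_J}`, with probability at least
`1 − exp(−(1/3)·n⁻²·2^{n(δ−ε−η_γ)})` over the random codebook,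
`|{m : 𝐱_J(m) = 𝐱_J}| ≥ (1 − n⁻¹)·2^{n(δ−ε−η_γ)}`. -/
theorem claim1_codeword_count_lower_bound
    {C : ℕ} (X : Fin C → Type) [∀ i, Fintype (X i)]
    (pinn : (∀ i, X i) → ℝ) (Z : ℕ) (hZ : 2 * Z < C)
    (pX : (∀ i, X i) → ℝ) (hpX : FeasibleB X pinn Z pX)
    (J : Finset (Fin C)) (hJ : J ∈ Jsets C Z)
    (δ : ℝ) (hδ : δ = objB pX Z - H2 (marg pX J))
    (ε : ℝ) (hε : 0 < ε) (hεδ : ε < δ)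
    (R : ℝ) (hR : R = objB pX Z - ε)
    (γ : ℝ) (hγ : 0 < γ)
    (pmin : ℝ) (hpmin : IsLeast {v | 0 < v ∧ ∃ y, marg pX J y = v} pmin)
    (ηγ : ℝ) (hη : ηγ = γ * Real.logb 2 (1 / pmin))
    (hεη : ε + ηγ < δ)
    (n : ℕ) (hn : 1 ≤ n)
    (xJ : Fin n → (i : {i // i ∈ J}) → X i.1) (hxJ : xJ ∈ typ (marg pX J) n γ) :
    1 - Real.exp (-(1 / 3) * ((n : ℝ) ^ 2)⁻¹ * (2 : ℝ) ^ ((n : ℝ) * (δ - ε - ηγ))) ≤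
      cbProb pX n (numMsgs n R) (fun cb =>
        (1 - (n : ℝ)⁻¹) * (2 : ℝ) ^ ((n : ℝ) * (δ - ε - ηγ)) ≤
          (matchCount cb J xJ : ℝ)) := by
  obtain ⟨⟨hp0, hp1⟩, -, -⟩ := hpX
  have hn0 : (0 : ℝ) < n := by exact_mod_cast hn
  have hm0 : ∀ y, 0 ≤ marg pX J y := by
    intro y
    refine Finset.sum_nonneg fun x _ => ?_
    split_ifs
    · exact hp0 x
    · exact le_rfl
  have hm1 : ∀ y, marg pX J y ≤ 1 := by
    intro y
    rw [← hp1]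
    refine Finset.sum_le_sum fun x _ => ?_
    split_ifs
    · exact le_rfl
    · exact hp0 x
  obtain ⟨⟨hpos, y0, hy0⟩, hlow⟩ := hpmin
  have hq := aux_typ (marg pX J) hm0 hm1 n hn γ pmin hpos (hy0 ▸ hm1 y0)
    (fun a ha => hlow ⟨ha, a, rfl⟩) xJ hxJ
  rw [← hη] at hq
  have key := aux_chernoff (fun v : Fin n → ∀ i, X i => ∏ t, pX (v t))
    (fun v => Finset.prod_nonneg fun t _ => hp0 _)
    (by rw [← Fintype.sum_pow, hp1, one_pow])
    (fun v => (fun t => restr J (v t)) = xJ) (numMsgs n R)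
    ((2 : ℝ) ^ ((n : ℝ) * (δ - ε - ηγ))) ((n : ℝ)⁻¹) (by positivity) (by positivity)
    (by
      have h0 := aux_match pX (restr J) n xJ
      refine le_trans (b := (numMsgs n R : ℝ) * ∏ t, marg pX J (xJ t)) ?_ (le_of_eq ?_)
      swap
      · congr 1
        unfold marg
        convert h0.symm
      have h1 : (2 : ℝ) ^ ((n : ℝ) * R) ≤ (numMsgs n R : ℝ) := Nat.le_ceil _
      have h2 : (2 : ℝ) ^ ((n : ℝ) * (δ - ε - ηγ)) =
          (2 : ℝ) ^ ((n : ℝ) * R) * (2 : ℝ) ^ (-(n : ℝ) * (H2 (marg pX J) + ηγ)) := by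
        rw [← Real.rpow_add (by norm_num), hδ, hR]
        congr 1
        ring
      rw [h2]
      exact mul_le_mul h1 hq (by positivity) (by positivity))
  rw [inv_pow] at key
  unfold cbProb matchCount
  convert key using 3
  simp only []
  congr!

end
end

section
/- Stealth of the random code (channel resolvability): Let 𝒰 and 𝒳 be finite sets, P_U a PMF on 𝒰 and P_{X|U} a channel from 𝒰 to PMFs on 𝒳, and let (U,X) have joint law P_U(u)·P_{X|U}(x|u) with X-marginal P_X. Suppose R > I(U;X). For each n, draw N = ⌈2^{nR}⌉ codewords 𝐮(1),…,𝐮(N) i.i.d. from the product distribution P_U^n and define the mixture PMF P̂ on 𝒳ⁿ by P̂(𝐱) = (1/N)·Σ_{m=1}^{N} P^n_{X|U}(𝐱 | 𝐮(m)), where P^n_{X|U} is the n-fold memoryless extension of the channel. Then V(P̂, P_X^n) → 0 in probability as n → ∞; indeed there exists a sequence f_n → 0 such that V(P̂, P_X^n) ≤ f_n with probability tending to 1 over the random codewords. -/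
open scoped BigOperators Classical
open Filter

noncomputable section

lemma sum_fin_succ_fun {Ω : Type} [Fintype Ω] (N : ℕ) (G : (Fin (N+1) → Ω) → ℝ) :
    ∑ c, G c = ∑ a, ∑ c : Fin N → Ω, G (Fin.cons a c) := by
  rw [← (Fin.consEquiv (fun _ => Ω)).sum_comp, Fintype.sum_prod_type]
  rfl

lemma mass_one {Ω : Type} [Fintype Ω] (w : Ω → ℝ) (hw : ∑ a, w a = 1) (N : ℕ) :
    ∑ c : Fin N → Ω, ∏ m, w (c m) = 1 := by
  induction N with
  | zero => simp
  | succ N ih =>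
    rw [sum_fin_succ_fun]
    simp only [Fin.prod_univ_succ, Fin.cons_zero, Fin.cons_succ, ← Finset.mul_sum, ih, mul_one, hw]

lemma first_moment {Ω : Type} [Fintype Ω] (w : Ω → ℝ) (hw : ∑ a, w a = 1) (N : ℕ)
    (g : Ω → ℝ) :
    ∑ c : Fin N → Ω, (∏ m, w (c m)) * ∑ m, g (c m) = N * ∑ a, w a * g a := by
  induction N with
  | zero => simp
  | succ N ih =>
    rw [sum_fin_succ_fun]
    simp only [Fin.prod_univ_succ, Fin.sum_univ_succ, Fin.cons_zero, Fin.cons_succ]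
    have : ∀ a, ∑ c : Fin N → Ω, (w a * ∏ m, w (c m)) * (g a + ∑ m, g (c m))
        = w a * g a + w a * (N * ∑ a, w a * g a) := by
      intro a
      rw [← ih]
      have h1 := mass_one w hw N
      calc _ = w a * g a * (∑ c : Fin N → Ω, ∏ m, w (c m))
            + w a * ∑ c : Fin N → Ω, (∏ m, w (c m)) * ∑ m, g (c m) := by
            rw [Finset.mul_sum, Finset.mul_sum, ← Finset.sum_add_distrib]
            exact Finset.sum_congr rfl fun c _ => by ring
        _ = _ := by rw [h1]; ring
    simp only [this, Finset.sum_add_distrib, ← Finset.sum_mul, hw]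
    push_cast; ring

lemma second_moment_s7 {Ω : Type} [Fintype Ω] (w : Ω → ℝ) (hw : ∑ a, w a = 1) (N : ℕ)
    (g : Ω → ℝ) (hg : ∑ a, w a * g a = 0) :
    ∑ c : Fin N → Ω, (∏ m, w (c m)) * (∑ m, g (c m))^2 = N * ∑ a, w a * g a ^ 2 := by
  induction N with
  | zero => simp
  | succ N ih =>
    rw [sum_fin_succ_fun]
    simp only [Fin.prod_univ_succ, Fin.sum_univ_succ, Fin.cons_zero, Fin.cons_succ]
    have : ∀ a, ∑ c : Fin N → Ω, (w a * ∏ m, w (c m)) * (g a + ∑ m, g (c m))^2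
        = w a * g a ^ 2 + w a * (N * ∑ a, w a * g a ^ 2) := by
      intro a
      rw [← ih]
      have h1 := mass_one w hw N
      have h2 := first_moment w hw N g
      rw [hg, mul_zero] at h2
      calc _ = w a * g a ^ 2 * (∑ c : Fin N → Ω, ∏ m, w (c m))
            + 2 * w a * g a * (∑ c : Fin N → Ω, (∏ m, w (c m)) * ∑ m, g (c m))
            + w a * ∑ c : Fin N → Ω, (∏ m, w (c m)) * (∑ m, g (c m)) ^ 2 := by
            rw [Finset.mul_sum, Finset.mul_sum, Finset.mul_sum, ← Finset.sum_add_distrib,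
              ← Finset.sum_add_distrib]
            exact Finset.sum_congr rfl fun c _ => by ring
        _ = _ := by rw [h1, h2]; ring
    simp only [this, Finset.sum_add_distrib, ← Finset.sum_mul, hw]
    push_cast; ring

lemma abs_dev {Ω : Type} [Fintype Ω] (w : Ω → ℝ) (hw0 : ∀ a, 0 ≤ w a) (hw : ∑ a, w a = 1)
    (N : ℕ) (hN : 0 < N) (F : Ω → ℝ) (μ : ℝ) (hμ : μ = ∑ a, w a * F a) :
    ∑ c : Fin N → Ω, (∏ m, w (c m)) * |(1 / (N:ℝ)) * ∑ m, F (c m) - μ|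
      ≤ Real.sqrt ((∑ a, w a * F a ^ 2) / N) := by
  have hN' : (0:ℝ) < N := by exact_mod_cast hN
  apply Real.le_sqrt_of_sq_le
  have hp : ∀ c : Fin N → Ω, 0 ≤ ∏ m, w (c m) := fun c => Finset.prod_nonneg fun m _ => hw0 _
  have cs := Finset.sum_sq_le_sum_mul_sum_of_sq_eq_mul (Finset.univ : Finset (Fin N → Ω))
    (r := fun c => (∏ m, w (c m)) * |(1 / (N:ℝ)) * ∑ m, F (c m) - μ|)
    (f := fun c => ∏ m, w (c m))
    (g := fun c => (∏ m, w (c m)) * ((1 / (N:ℝ)) * ∑ m, F (c m) - μ)^2)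
    (fun c _ => hp c) (fun c _ => mul_nonneg (hp c) (sq_nonneg _))
    (fun c _ => by rw [mul_pow, sq_abs]; ring)
  rw [mass_one w hw, one_mul] at cs
  refine cs.trans ?_
  have h0 : ∑ a, w a * (F a - μ) = 0 := by
    simp only [mul_sub, Finset.sum_sub_distrib, ← Finset.sum_mul, hw, ← hμ]; ring
  have h2 := second_moment_s7 w hw N (fun a => F a - μ) h0
  have e : ∀ c : Fin N → Ω, (∏ m, w (c m)) * ((1 / (N:ℝ)) * ∑ m, F (c m) - μ)^2
      = (1 / (N:ℝ))^2 * ((∏ m, w (c m)) * (∑ m, (F (c m) - μ))^2) := by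
    intro c
    have : (1 / (N:ℝ)) * ∑ m, F (c m) - μ = (1 / (N:ℝ)) * ∑ m, (F (c m) - μ) := by
      rw [Finset.sum_sub_distrib]; simp; field_simp
    rw [this]; ring
  simp only [e, ← Finset.mul_sum]
  rw [h2]
  have h3 : ∑ a, w a * (F a - μ)^2 ≤ ∑ a, w a * F a ^ 2 := by
    have : ∑ a, w a * (F a - μ)^2 = ∑ a, w a * F a ^ 2 - μ^2 := by
      have : ∀ a, w a * (F a - μ)^2 = w a * F a ^ 2 - 2 * μ * (w a * F a) + μ^2 * w a := by
        intro a; ring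
      simp only [this, Finset.sum_add_distrib, Finset.sum_sub_distrib, ← Finset.mul_sum, hw, ← hμ]
      ring
    rw [this]; nlinarith [sq_nonneg μ]
  have : (1 / (N:ℝ))^2 * (N * ∑ a, w a * (F a - μ)^2) = (∑ a, w a * (F a - μ)^2) / N := by
    field_simp
  rw [this]
  gcongr

lemma one_shot {Ω X : Type} [Fintype Ω] [Fintype X] (w : Ω → ℝ) (hw0 : ∀ a, 0 ≤ w a)
    (hw : ∑ a, w a = 1) (W : Ω → X → ℝ) (hW0 : ∀ u x, 0 ≤ W u x) (Q : X → ℝ)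
    (hQ : ∀ x, Q x = ∑ u, w u * W u x) (hQ1 : ∑ x, Q x = 1) (T : ℝ) (hT : 0 ≤ T)
    (N : ℕ) (hN : 0 < N) :
    ∑ c : Fin N → Ω, (∏ m, w (c m)) * ∑ x, |(1 / (N:ℝ)) * ∑ m, W (c m) x - Q x|
      ≤ Real.sqrt (T / N) + 2 * ∑ u, ∑ x, w u * (if W u x ≤ T * Q x then 0 else W u x) := by
  have hN' : (0:ℝ) < N := by exact_mod_cast hN
  have hp : ∀ c : Fin N → Ω, 0 ≤ ∏ m, w (c m) := fun c => Finset.prod_nonneg fun m _ => hw0 _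
  set W1 : Ω → X → ℝ := fun u x => if W u x ≤ T * Q x then W u x else 0 with hW1
  set W2 : Ω → X → ℝ := fun u x => if W u x ≤ T * Q x then 0 else W u x with hW2
  have hsum : ∀ u x, W u x = W1 u x + W2 u x := by
    intro u x; simp only [hW1, hW2]; split_ifs <;> simp
  have hW10 : ∀ u x, 0 ≤ W1 u x := by
    intro u x; simp only [hW1]; split_ifs; exacts [hW0 _ _, le_rfl]
  have hW20 : ∀ u x, 0 ≤ W2 u x := by
    intro u x; simp only [hW2]; split_ifs; exacts [le_rfl, hW0 _ _]
  have hQ0 : ∀ x, 0 ≤ Q x := fun x => by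
    rw [hQ]; exact Finset.sum_nonneg fun u _ => mul_nonneg (hw0 _) (hW0 _ _)
  have key : ∀ x, ∑ c : Fin N → Ω, (∏ m, w (c m)) * |(1 / (N:ℝ)) * ∑ m, W (c m) x - Q x|
      ≤ Q x * Real.sqrt (T / N) + 2 * ∑ u, w u * W2 u x := by
    intro x
    have a1 := abs_dev w hw0 hw N hN (fun u => W1 u x) _ rfl
    have a2 := first_moment w hw N (fun u => W2 u x)
    have hQ2 : Q x = ∑ u, w u * W1 u x + ∑ u, w u * W2 u x := by
      rw [hQ, ← Finset.sum_add_distrib]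
      exact Finset.sum_congr rfl fun u _ => by rw [hsum]; ring
    have h20 : 0 ≤ ∑ u, w u * W2 u x :=
      Finset.sum_nonneg fun u _ => mul_nonneg (hw0 _) (hW20 _ _)
    have b1 : Real.sqrt ((∑ a, w a * W1 a x ^ 2) / N) ≤ Q x * Real.sqrt (T / N) := by
      have : (∑ a, w a * W1 a x ^ 2) ≤ Q x ^ 2 * T := by
        calc _ ≤ ∑ a, T * Q x * (w a * W1 a x) := by
              apply Finset.sum_le_sum
              intro a _
              have : W1 a x ≤ T * Q x := by
                simp only [hW1]; split_ifs with h
                exacts [h, mul_nonneg hT (hQ0 x)]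
              nlinarith [mul_nonneg (mul_nonneg (hw0 a) (hW10 a x)) (sub_nonneg.2 this)]
          _ = T * Q x * ∑ a, w a * W1 a x := by rw [Finset.mul_sum]
          _ ≤ T * Q x * Q x := by
              apply mul_le_mul_of_nonneg_left _ (mul_nonneg hT (hQ0 x))
              linarith
          _ = _ := by ring
      calc _ ≤ Real.sqrt (Q x ^ 2 * (T / N)) := by
            apply Real.sqrt_le_sqrt
            rw [← mul_div_assoc]
            gcongr
        _ = _ := by rw [Real.sqrt_mul (sq_nonneg _), Real.sqrt_sq (hQ0 x)]
    calc _ ≤ ∑ c : Fin N → Ω, ((∏ m, w (c m)) * |(1 / (N:ℝ)) * ∑ m, W1 (c m) x - ∑ a, w a * W1 a x|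
          + (1/(N:ℝ)) * ((∏ m, w (c m)) * ∑ m, W2 (c m) x)
          + (∏ m, w (c m)) * ∑ u, w u * W2 u x) := by
          apply Finset.sum_le_sum
          intro c _
          have e : (1 / (N:ℝ)) * ∑ m, W (c m) x - Q x
            = ((1 / (N:ℝ)) * ∑ m, W1 (c m) x - ∑ a, w a * W1 a x)
              + ((1 / (N:ℝ)) * ∑ m, W2 (c m) x - ∑ a, w a * W2 a x) := by
            rw [hQ2]; simp only [hsum, Finset.sum_add_distrib]; ring
          have h3 : 0 ≤ (1 / (N:ℝ)) * ∑ m, W2 (c m) x :=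
            mul_nonneg (by positivity) (Finset.sum_nonneg fun m _ => hW20 _ _)
          have : |(1 / (N:ℝ)) * ∑ m, W (c m) x - Q x|
            ≤ |(1 / (N:ℝ)) * ∑ m, W1 (c m) x - ∑ a, w a * W1 a x|
              + ((1 / (N:ℝ)) * ∑ m, W2 (c m) x + ∑ a, w a * W2 a x) := by
            rw [e]
            refine (abs_add_le _ _).trans ?_
            gcongr
            rw [abs_le]; constructor <;> linarith
          calc _ ≤ _ := mul_le_mul_of_nonneg_left this (hp c)
            _ = _ := by ring
      _ = (∑ c : Fin N → Ω, (∏ m, w (c m)) * |(1 / (N:ℝ)) * ∑ m, W1 (c m) x - ∑ a, w a * W1 a x|)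
          + 2 * ∑ u, w u * W2 u x := by
          rw [Finset.sum_add_distrib, Finset.sum_add_distrib, ← Finset.mul_sum, a2,
            ← Finset.sum_mul, mass_one w hw]
          field_simp
          ring
      _ ≤ _ := by linarith
  calc _ = ∑ x, ∑ c : Fin N → Ω, (∏ m, w (c m)) * |(1 / (N:ℝ)) * ∑ m, W (c m) x - Q x| := by
        rw [Finset.sum_comm]
        simp only [Finset.mul_sum]
    _ ≤ ∑ x, (Q x * Real.sqrt (T / N) + 2 * ∑ u, w u * W2 u x) :=
        Finset.sum_le_sum fun x _ => key x
    _ = _ := by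
        rw [Finset.sum_add_distrib, ← Finset.sum_mul, hQ1, one_mul, ← Finset.mul_sum,
          Finset.sum_comm]

lemma MI2_eq {U A : Type} [Fintype U] [Fintype A]
    (pU : U → ℝ) (k : U → A → ℝ) (hpU : IsPMF pU) (hk : ∀ u, IsPMF (k u)) :
    MI2 (fun q : U × A => pU q.1 * k q.1 q.2) =
      ∑ q : U × A, pU q.1 * k q.1 q.2 *
        (Real.logb 2 (k q.1 q.2) - Real.logb 2 (∑ u, pU u * k u q.2)) := by
  have m1 : margFst (fun q : U × A => pU q.1 * k q.1 q.2) = pU := by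
    funext u; simp [margFst, ← Finset.mul_sum, (hk u).2]
  have e1 : ∑ u, pU u * Real.logb 2 (pU u)
      = ∑ q : U × A, pU q.1 * k q.1 q.2 * Real.logb 2 (pU q.1) := by
    rw [Fintype.sum_prod_type]
    refine Finset.sum_congr rfl fun u _ => ?_
    simp only [← Finset.sum_mul, ← Finset.mul_sum, (hk u).2, mul_one]
  have e2 : ∑ a, (∑ u, pU u * k u a) * Real.logb 2 (∑ u, pU u * k u a)
      = ∑ q : U × A, pU q.1 * k q.1 q.2 * Real.logb 2 (∑ u, pU u * k u q.2) := by
    rw [Fintype.sum_prod_type_right]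
    refine Finset.sum_congr rfl fun a _ => ?_
    rw [Finset.sum_mul]
  unfold MI2
  rw [m1]
  unfold H2 margSnd
  rw [e1, e2, ← Finset.sum_neg_distrib, ← Finset.sum_neg_distrib, ← Finset.sum_neg_distrib,
    ← Finset.sum_add_distrib, ← Finset.sum_sub_distrib]
  refine Finset.sum_congr rfl fun q _ => ?_
  by_cases h1 : pU q.1 = 0
  · simp [h1]
  by_cases h2 : k q.1 q.2 = 0
  · simp [h2]
  rw [Real.logb_mul h1 h2]; ring

lemma atypical {U A : Type} [Fintype U] [Fintype A]
    (pU : U → ℝ) (k : U → A → ℝ) (hpU : IsPMF pU) (hk : ∀ u, IsPMF (k u))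
    (I δ : ℝ) (hδ : 0 < δ) (hI : I = MI2 (fun q : U × A => pU q.1 * k q.1 q.2)) :
    ∃ C : ℝ, 0 ≤ C ∧ ∀ n : ℕ, 0 < n →
      ∑ u : Fin n → U, ∑ x : Fin n → A, (∏ t, pU (u t)) *
        (if ∏ t, k (u t) (x t) ≤ (2:ℝ) ^ ((n:ℝ) * (I + δ)) * ∏ t, (∑ u, pU u * k u (x t)) then 0
          else ∏ t, k (u t) (x t)) ≤ C / n := by
  set p : U × A → ℝ := fun q => pU q.1 * k q.1 q.2 with hp
  set g : U × A → ℝ := fun q =>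
    Real.logb 2 (k q.1 q.2) - Real.logb 2 (∑ u, pU u * k u q.2) - I with hg
  have p0 : ∀ q, 0 ≤ p q := fun q => mul_nonneg (hpU.1 _) ((hk _).1 _)
  have p1 : ∑ q, p q = 1 := by
    rw [Fintype.sum_prod_type]
    simp only [hp, ← Finset.mul_sum, (hk _).2, mul_one, hpU.2]
  have pg : ∑ q, p q * g q = 0 := by
    simp only [hg, mul_sub _ _ I, Finset.sum_sub_distrib, ← Finset.sum_mul, p1]
    rw [hI, MI2_eq pU k hpU hk]; simp [hp]
  refine ⟨(∑ q, p q * g q ^ 2) / δ ^ 2, div_nonneg (Finset.sum_nonneg fun q _ =>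
    mul_nonneg (p0 q) (sq_nonneg _)) (sq_nonneg _), fun n hn => ?_⟩
  have hn' : (0:ℝ) < n := by exact_mod_cast hn
  have sm := second_moment_s7 p p1 n g pg
  have step : ∀ (u : Fin n → U) (x : Fin n → A), (∏ t, pU (u t)) *
        (if ∏ t, k (u t) (x t) ≤ (2:ℝ) ^ ((n:ℝ) * (I + δ)) * ∏ t, (∑ u, pU u * k u (x t)) then 0
          else ∏ t, k (u t) (x t)) ≤
        (1 / (n * δ)^2) * ((∏ t, p (u t, x t)) * (∑ t, g (u t, x t))^2) := by
    intro u x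
    have P0 : 0 ≤ ∏ t, p (u t, x t) := Finset.prod_nonneg fun t _ => p0 _
    have R0 : 0 ≤ (1 / (n * δ)^2) * ((∏ t, p (u t, x t)) * (∑ t, g (u t, x t))^2) := by positivity
    split_ifs with h
    · simpa using R0
    have Pe : (∏ t, pU (u t)) * ∏ t, k (u t) (x t) = ∏ t, p (u t, x t) := by
      rw [← Finset.prod_mul_distrib]
    rw [Pe]
    by_cases hz : ∏ t, p (u t, x t) = 0
    · rw [hz]; simp
    have hne : ∀ t, p (u t, x t) ≠ 0 := fun t => (Finset.prod_ne_zero_iff.1 hz) t (Finset.mem_univ _)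
    have kpos : ∀ t, 0 < k (u t) (x t) := fun t =>
      lt_of_le_of_ne ((hk _).1 _) (fun h => hne t (by simp [hp, ← h]))
    have qpos : ∀ t, 0 < ∑ u, pU u * k u (x t) := fun t => by
      refine lt_of_lt_of_le (lt_of_le_of_ne (p0 _) (hne t).symm) ?_
      exact Finset.single_le_sum (f := fun v => pU v * k v (x t))
        (fun v _ => mul_nonneg (hpU.1 v) ((hk v).1 _)) (Finset.mem_univ (u t))
    push Not at h
    have hQ : 0 < ∏ t, (∑ u, pU u * k u (x t)) := Finset.prod_pos fun t _ => qpos t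
    have hl := Real.logb_lt_logb (b := 2) (by norm_num) (by positivity) h
    rw [Real.logb_mul (by positivity) hQ.ne', Real.logb_rpow (by norm_num) (by norm_num),
      Real.logb_prod _ _ (fun t _ => (qpos t).ne'),
      Real.logb_prod _ _ (fun t _ => (kpos t).ne')] at hl
    have hs : n * δ ≤ ∑ t, g (u t, x t) := by
      simp only [hg, Finset.sum_sub_distrib]
      simp
      linarith
    have hsq : (n * δ)^2 ≤ (∑ t, g (u t, x t))^2 := by
      apply pow_le_pow_left₀ (by positivity) hs
    have : 1 ≤ (1 / (n * δ)^2) * (∑ t, g (u t, x t))^2 := by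
      rw [one_div, inv_mul_eq_div, le_div_iff₀ (by positivity)]; linarith
    nlinarith
  calc _ ≤ ∑ u : Fin n → U, ∑ x : Fin n → A,
        (1 / (n * δ)^2) * ((∏ t, p (u t, x t)) * (∑ t, g (u t, x t))^2) :=
        Finset.sum_le_sum fun u _ => Finset.sum_le_sum fun x _ => step u x
    _ = (1 / (n * δ)^2) * ∑ c : Fin n → U × A, (∏ t, p (c t)) * (∑ t, g (c t))^2 := by
        rw [← (Equiv.arrowProdEquivProdArrow (Fin n) (fun _ => U) (fun _ => A)).symm.sum_comp,
          Fintype.sum_prod_type, Finset.mul_sum]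
        refine Finset.sum_congr rfl fun u _ => ?_
        rw [Finset.mul_sum]
        rfl
    _ = _ := by rw [sm]; field_simp

lemma markov {Ω : Type} [Fintype Ω] (w V : Ω → ℝ) (hw0 : ∀ a, 0 ≤ w a) (hw : ∑ a, w a = 1)
    (hV : ∀ a, 0 ≤ V a) (g : ℝ) (hg : 0 < g) (h : ∑ a, w a * V a ≤ g) :
    1 - Real.sqrt g ≤ ∑ a, if V a ≤ Real.sqrt g then w a else 0 := by
  have hs : 0 < Real.sqrt g := Real.sqrt_pos.2 hg
  have h1 : ∑ a, (w a - if V a ≤ Real.sqrt g then w a else 0) ≤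
      ∑ a, (1 / Real.sqrt g) * (w a * V a) := by
    apply Finset.sum_le_sum
    intro a _
    have := hw0 a
    have := hV a
    split_ifs with hh
    · rw [sub_self]; positivity
    · push Not at hh
      have : 1 ≤ (1 / Real.sqrt g) * V a := by
        rw [one_div, inv_mul_eq_div, le_div_iff₀ hs]; linarith
      nlinarith
  rw [Finset.sum_sub_distrib, hw, ← Finset.mul_sum] at h1
  have h2 : (1 / Real.sqrt g) * ∑ a, w a * V a ≤ Real.sqrt g := by
    rw [one_div, inv_mul_eq_div, div_le_iff₀ hs, Real.mul_self_sqrt hg.le]; exact h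
  linarith

/-- **Stealth of the random code (channel resolvability).**
If `R > I(U;X)` and, for each `n`, `N = ⌈2^{nR}⌉` codewords are drawn i.i.d. from
`P_U^n`, then the total variation distance between the uniform mixture
`P̂(𝐱) = (1/N)·Σ_m P^n_{X|U}(𝐱|𝐮(m))` and the product `P_X^n` tends to `0` in
probability; indeed there is a sequence `f_n → 0` with
`P(V(P̂, P_X^n) ≤ f_n) → 1`. -/
theorem channel_resolvability
    (U A : Type) [Fintype U] [Fintype A]
    (pU : U → ℝ) (hpU : IsPMF pU)
    (k : U → A → ℝ) (hk : ∀ u, IsPMF (k u))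
    (R : ℝ) (hR : MI2 (fun q : U × A => pU q.1 * k q.1 q.2) < R) :
    ∃ f : ℕ → ℝ,
      Tendsto f atTop (nhds 0) ∧
      Tendsto (fun n : ℕ =>
          cbProb pU n (numMsgs n R) (fun cb =>
            tvDist
              (fun x : Fin n → A =>
                (1 / (numMsgs n R : ℝ)) * ∑ m, ∏ t, k (cb m t) (x t))
              (prodPMF (fun a => ∑ u, pU u * k u a) n) ≤ f n))
        atTop (nhds 1) := by
  set I := MI2 (fun q : U × A => pU q.1 * k q.1 q.2) with hI
  set δ := (R - I) / 2 with hδd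
  have hδ : 0 < δ := by rw [hδd]; linarith
  obtain ⟨C, hC0, hC⟩ := atypical pU k hpU hk I δ hδ hI
  set g : ℕ → ℝ := fun n => Real.sqrt (((2:ℝ) ^ (-δ)) ^ n) + 2 * (C / n) with hg
  have hgpos : ∀ n, 0 < g n := fun n => by simp only [hg]; positivity
  have hgt : Tendsto g atTop (nhds 0) := by
    have h1 : Tendsto (fun n : ℕ => ((2:ℝ) ^ (-δ)) ^ n) atTop (nhds 0) :=
      tendsto_pow_atTop_nhds_zero_of_lt_one (by positivity)
        (Real.rpow_lt_one_of_one_lt_of_neg (by norm_num) (by linarith))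
    have h2 := (Real.continuous_sqrt.tendsto 0).comp h1
    have h3 := (tendsto_const_div_atTop_nhds_zero_nat C).const_mul 2
    simpa [hg] using h2.add h3
  have hft : Tendsto (fun n => Real.sqrt (g n)) atTop (nhds 0) := by
    simpa [Function.comp_def] using (Real.continuous_sqrt.tendsto 0).comp hgt
  refine ⟨fun n => Real.sqrt (g n), hft, ?_⟩
  have hw0 : ∀ (n : ℕ) (u : Fin n → U), 0 ≤ ∏ t, pU (u t) :=
    fun n u => Finset.prod_nonneg fun t _ => hpU.1 _
  have hw1 : ∀ n : ℕ, ∑ u : Fin n → U, ∏ t, pU (u t) = 1 := mass_one pU hpU.2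
  have hlow : Tendsto (fun n => 1 - Real.sqrt (g n)) atTop (nhds 1) := by
    simpa using hft.const_sub 1
  refine tendsto_of_tendsto_of_tendsto_of_le_of_le' hlow tendsto_const_nhds ?_ ?_
  · filter_upwards [eventually_gt_atTop 0] with n hn
    set N := numMsgs n R with hN
    have hNge : (2:ℝ) ^ ((n:ℝ) * R) ≤ N := Nat.le_ceil _
    have hNpos' : (0:ℝ) < N := lt_of_lt_of_le (by positivity) hNge
    have hNpos : 0 < N := by exact_mod_cast hNpos'
    unfold cbProb
    refine markov (fun cb : Fin N → Fin n → U => ∏ m, ∏ t, pU (cb m t)) _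
      (fun cb => Finset.prod_nonneg fun m _ => hw0 n _)
      (mass_one (fun u : Fin n → U => ∏ t, pU (u t)) (hw1 n) N)
      (fun cb => mul_nonneg (by norm_num) (Finset.sum_nonneg fun x _ => abs_nonneg _))
      (g n) (hgpos n) ?_
    have hQ : ∀ x : Fin n → A, prodPMF (fun a => ∑ u, pU u * k u a) n x
        = ∑ u : Fin n → U, (∏ t, pU (u t)) * ∏ t, k (u t) (x t) := by
      intro x
      unfold prodPMF
      simp only [← Finset.prod_mul_distrib]
      rw [Finset.prod_univ_sum, Fintype.piFinset_univ]
    have hQ1 : ∑ x : Fin n → A, prodPMF (fun a => ∑ u, pU u * k u a) n x = 1 := by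
      apply mass_one (fun a => ∑ u, pU u * k u a)
      rw [Finset.sum_comm]
      simp only [← Finset.mul_sum, (hk _).2, mul_one, hpU.2]
    have os := one_shot (fun u : Fin n → U => ∏ t, pU (u t)) (hw0 n) (hw1 n)
      (fun u (x : Fin n → A) => ∏ t, k (u t) (x t))
      (fun u x => Finset.prod_nonneg fun t _ => (hk _).1 _)
      (prodPMF (fun a => ∑ u, pU u * k u a) n) hQ hQ1 ((2:ℝ) ^ ((n:ℝ) * (I + δ)))
      (by positivity) N hNpos
    have hat := hC n hn
    have hsq : Real.sqrt ((2:ℝ) ^ ((n:ℝ) * (I + δ)) / N) ≤ Real.sqrt (((2:ℝ) ^ (-δ)) ^ n) := by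
      apply Real.sqrt_le_sqrt
      rw [div_le_iff₀ hNpos', ← Real.rpow_natCast, ← Real.rpow_mul (by norm_num)]
      calc _ = (2:ℝ) ^ (-δ * n) * (2:ℝ) ^ ((n:ℝ) * R) := by
            rw [← Real.rpow_add (by norm_num)]
            congr 1
            rw [hδd]; ring
        _ ≤ _ := by gcongr
    have hE : ∑ cb : Fin N → Fin n → U, (∏ m, ∏ t, pU (cb m t)) *
        ∑ x : Fin n → A, |(1 / (N:ℝ)) * ∑ m, ∏ t, k (cb m t) (x t)
          - prodPMF (fun a => ∑ u, pU u * k u a) n x| ≤ g n := by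
      refine os.trans ?_
      simp only [hg]
      unfold prodPMF
      linarith
    simp only [mul_left_comm _ (1/2 : ℝ), ← Finset.mul_sum]
    have := hgpos n
    linarith
  · refine Eventually.of_forall fun n => ?_
    unfold cbProb
    rw [← mass_one (fun u : Fin n → U => ∏ t, pU (u t)) (hw1 n) (numMsgs n R)]
    apply Finset.sum_le_sum
    intro cb _
    split_ifs
    · exact le_rfl
    · exact Finset.prod_nonneg fun m _ => hw0 n _
end
end

section
/- Strong asymptotic equipartition bound with explicit constant: Let P_X be a PMF on a finite set 𝒳, let γ > 0, let p_min be the least positive value of P_X, and set η_γ = γ·log₂(1/p_min). Then for every n ≥ 1 and every 𝐱 ∈ A^{n,γ}_X, 2^{−n(H(X)+η_γ)} ≤ P_X^n(𝐱) ≤ 2^{−n(H(X)−η_γ)}, where P_X^n is the n-fold product PMF and H(X) is the Shannon entropy of P_X in bits. -/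
open scoped BigOperators Classical
open Filter

noncomputable section

/-- **Strong AEP bound with explicit constant.** For a PMF `P_X` on a finite set,
`γ > 0`, least positive value `p_min` of `P_X`, and `η_γ = γ·log₂(1/p_min)`:
for every `n ≥ 1` and every `𝐱 ∈ A^{n,γ}_X`,
`2^{−n(H(X)+η_γ)} ≤ P_X^n(𝐱) ≤ 2^{−n(H(X)−η_γ)}`. -/
theorem strong_AEP_bound
    {A : Type} [Fintype A]
    (p : A → ℝ) (hp : IsPMF p)
    (γ : ℝ) (hγ : 0 < γ)
    (pmin : ℝ) (hpmin : IsLeast {v : ℝ | 0 < v ∧ ∃ a, p a = v} pmin)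
    (ηγ : ℝ) (hη : ηγ = γ * Real.logb 2 (1 / pmin))
    (n : ℕ) (hn : 1 ≤ n)
    (x : Fin n → A) (hx : x ∈ typ p n γ) :
    (2 : ℝ) ^ (-(n : ℝ) * (H2 p + ηγ)) ≤ prodPMF p n x ∧
    prodPMF p n x ≤ (2 : ℝ) ^ (-(n : ℝ) * (H2 p - ηγ)) := by
  obtain ⟨hp0, hp1⟩ := hp
  obtain ⟨⟨hm0, a0, ha0⟩, hmin⟩ := hpmin
  have hle : ∀ a, p a ≤ 1 := fun a => by
    rw [← hp1]
    exact Finset.single_le_sum (fun i _ => hp0 i) (Finset.mem_univ a)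
  simp only [typ, Finset.mem_filter, Finset.mem_univ, true_and] at hx
  obtain ⟨hx0, hxγ⟩ := hx
  have hn0 : (0 : ℝ) < n := by exact_mod_cast hn
  have hpos : ∀ t, 0 < p (x t) := by
    intro t
    refine lt_of_le_of_ne (hp0 _) (fun h => ?_)
    have h1 := hx0 (x t) h.symm
    simp only [countOcc, Finset.card_eq_zero] at h1
    have h2 : t ∈ Finset.univ.filter (fun s => x s = x t) := by simp
    rw [h1] at h2
    simp at h2
  have hprod : 0 < prodPMF p n x := Finset.prod_pos (fun t _ => hpos t)
  have hlog : Real.logb 2 (prodPMF p n x) = ∑ a, (countOcc a x : ℝ) * Real.logb 2 (p a) := by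
    unfold prodPMF
    rw [Real.logb_prod _ _ (fun t _ => (hpos t).ne'),
      ← Finset.sum_fiberwise Finset.univ x (fun t => Real.logb 2 (p (x t)))]
    refine Finset.sum_congr rfl (fun a _ => ?_)
    rw [Finset.sum_congr rfl (g := fun _ => Real.logb 2 (p a))
      (fun t ht => by rw [(Finset.mem_filter.mp ht).2])]
    rw [Finset.sum_const, nsmul_eq_mul]
    rfl
  set L := Real.logb 2 (1 / pmin) with hL
  have hL' : L = - Real.logb 2 pmin := by rw [hL, one_div, Real.logb_inv]
  have hL0 : 0 ≤ L := by
    have := Real.logb_nonpos (b := 2) (by norm_num) hm0.le (ha0 ▸ hle a0)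
    linarith
  have hl : ∀ a, |Real.logb 2 (p a)| ≤ L := by
    intro a
    rcases (hp0 a).eq_or_lt with h | h
    · rw [← h]; simpa using hL0
    · rw [abs_of_nonpos (Real.logb_nonpos (by norm_num) h.le (hle a)), hL']
      have := Real.logb_le_logb_of_le (b := 2) (by norm_num) hm0 (hmin ⟨h, a, rfl⟩)
      linarith
  have key : |∑ a, ((countOcc a x : ℝ) / n - p a) * Real.logb 2 (p a)| ≤ ηγ := by
    calc _ ≤ ∑ a, |((countOcc a x : ℝ) / n - p a) * Real.logb 2 (p a)| :=
          Finset.abs_sum_le_sum_abs _ _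
      _ ≤ ∑ a, |(countOcc a x : ℝ) / n - p a| * L := by
          refine Finset.sum_le_sum (fun a _ => ?_)
          rw [abs_mul]
          exact mul_le_mul_of_nonneg_left (hl a) (abs_nonneg _)
      _ = (∑ a, |(countOcc a x : ℝ) / n - p a|) * L := by rw [Finset.sum_mul]
      _ ≤ γ * L := mul_le_mul_of_nonneg_right hxγ hL0
      _ = ηγ := hη.symm
  have heq : Real.logb 2 (prodPMF p n x) =
      n * (∑ a, ((countOcc a x : ℝ) / n - p a) * Real.logb 2 (p a) - H2 p) := by
    rw [hlog, H2, sub_neg_eq_add, ← Finset.sum_add_distrib, Finset.mul_sum]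
    refine Finset.sum_congr rfl (fun a _ => ?_)
    field_simp
    ring
  obtain ⟨k1, k2⟩ := abs_le.mp key
  constructor
  · rw [← Real.le_logb_iff_rpow_le (by norm_num) hprod, heq]
    nlinarith
  · rw [← Real.logb_le_iff_le_rpow (by norm_num) hprod, heq]
    nlinarith
end
end

section
/- Typical-part discrepancy bound (term A₁ ≤ 1/(2n)): Let P_{UX_J} be a joint PMF on the product of finite sets 𝒰 × 𝒳_J, let γ > 0, n ≥ 1, N ≥ 1, and let 𝐮(1),…,𝐮(N) ∈ 𝒰ⁿ be arbitrary. For 𝐱_J ∈ A^{n,γ}_{X_J}, let A_{U𝐱_J} = {𝐮 ∈ 𝒰ⁿ : (𝐮,𝐱_J) ∈ A^{n,γ}_{UX_J}}, and partition A_{U𝐱_J} into joint type classes T (maximal subsets on which the pair-count function 𝐮 ↦ N(·,·;𝐮,𝐱_J) is constant). Suppose that for every 𝐱_J ∈ A^{n,γ}_{X_J} and every nonempty joint type class T ⊆ A_{U𝐱_J} one has |P_U^n(T) − |{m : 𝐮(m) ∈ T}|/N| ≤ n^{−1}·P_U^n(T). Then (1/2)·Σ_{𝐱_J ∈ A^{n,γ}_{X_J}}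 | Σ_{𝐮 ∈ A_{U𝐱_J}} P_U^n(𝐮)·P^n_{X_J|U}(𝐱_J|𝐮) − (1/N)·Σ_{m : 𝐮(m) ∈ A_{U𝐱_J}} P^n_{X_J|U}(𝐱_J|𝐮(m)) | ≤ 1/(2n). -/
open scoped BigOperators Classical
open Filter

noncomputable section

/-- The `n`-fold memoryless extension of a channel `k : 𝒰 → PMFs on 𝒳`. -/
def chanN {U A : Type} (k : U → A → ℝ) (n : ℕ) (u : Fin n → U) (x : Fin n → A) : ℝ :=
  ∏ t, k (u t) (x t)

/-- The conditionally typical set `A_{U𝐱_J} = {𝐮 : (𝐮,𝐱_J) ∈ A^{n,γ}_{UX_J}}`,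
where joint typicality of `(𝐮,𝐱_J)` is typicality of the paired string for the
joint PMF. -/
def condTypSet {U A : Type} [Fintype U] [Fintype A]
    (pjoint : U × A → ℝ) (n : ℕ) (γ : ℝ) (xJ : Fin n → A) : Finset (Fin n → U) :=
  Finset.univ.filter (fun u => (fun t => (u t, xJ t)) ∈ typ pjoint n γ)

/-- The joint type class inside `A_{U𝐱_J}` determined by the pair-count function
`c : 𝒰 × 𝒳_J → ℕ`: the set of `𝐮 ∈ A_{U𝐱_J}` with `N(u,a; 𝐮,𝐱_J) = c (u,a)` for all
`(u,a)`.  The nonempty such sets are exactly the maximal subsets of `A_{U𝐱_J}` on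
which the pair-count function is constant. -/
def typeClass {U A : Type} [Fintype U] [Fintype A]
    (pjoint : U × A → ℝ) (n : ℕ) (γ : ℝ) (xJ : Fin n → A) (c : U × A → ℕ) :
    Finset (Fin n → U) :=
  (condTypSet pjoint n γ xJ).filter
    (fun u => (fun ab => countOcc ab (fun t => (u t, xJ t))) = c)

theorem aux_chanN_eq {U A : Type} [Fintype U] [Fintype A] (k : U → A → ℝ) (n : ℕ)
    (u : Fin n → U) (x : Fin n → A) :
    chanN k n u x = ∏ ab : U × A, k ab.1 ab.2 ^ (countOcc ab (fun t => (u t, x t))) := by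
  unfold chanN countOcc
  rw [← Finset.prod_fiberwise_of_maps_to (s := Finset.univ) (t := Finset.univ)
    (g := fun t => (u t, x t)) (fun _ _ => Finset.mem_univ _)]
  refine Finset.prod_congr rfl fun ab _ => ?_
  rw [← Finset.prod_const]
  refine Finset.prod_congr (by ext t; simp) fun t ht => ?_
  have h : (u t, x t) = ab := by simpa using ht
  rw [← h]

theorem aux_sum_prod {α : Type} [Fintype α] (n : ℕ) (f : Fin n → α → ℝ)
    (hf : ∀ t, ∑ a, f t a = 1) : ∑ x : Fin n → α, ∏ t, f t (x t) = 1 := by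
  rw [← Fintype.prod_sum]
  simp [hf]

theorem aux_fiber {U A : Type} [Fintype U] [Fintype A] (pU : U → ℝ)
    (k : U → A → ℝ) (hk : ∀ u a, 0 ≤ k u a) (pj : U × A → ℝ) (γ : ℝ) (n N : ℕ)
    (uw : Fin N → Fin n → U) (x : Fin n → A)
    (h : ∀ c : U × A → ℕ, (typeClass pj n γ x c).Nonempty →
      |(∑ u ∈ typeClass pj n γ x c, prodPMF pU n u) -
        ((Finset.univ.filter (fun m => uw m ∈ typeClass pj n γ x c)).card : ℝ) / N| ≤
        (n : ℝ)⁻¹ * ∑ u ∈ typeClass pj n γ x c, prodPMF pU n u) :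
    |(∑ u ∈ condTypSet pj n γ x, prodPMF pU n u * chanN k n u x) -
        (1 / N : ℝ) * ∑ m ∈ Finset.univ.filter (fun m => uw m ∈ condTypSet pj n γ x),
          chanN k n (uw m) x| ≤
      (n : ℝ)⁻¹ * ∑ u ∈ condTypSet pj n γ x, prodPMF pU n u * chanN k n u x := by
  set cnt : (Fin n → U) → (U × A → ℕ) :=
    fun u => (fun ab => countOcc ab (fun t => (u t, x t))) with hcnt
  set g : (U × A → ℕ) → ℝ := fun c => ∏ ab : U × A, k ab.1 ab.2 ^ c ab with hg
  have hg0 : ∀ c, 0 ≤ g c := fun c => Finset.prod_nonneg fun ab _ => pow_nonneg (hk _ _) _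
  have hch : ∀ u, chanN k n u x = g (cnt u) := fun u => aux_chanN_eq k n u x
  set S := condTypSet pj n γ x with hS
  have hT : ∀ c, typeClass pj n γ x c = S.filter (fun u => cnt u = c) := fun c => rfl
  have e1 : ∑ u ∈ S, prodPMF pU n u * chanN k n u x =
      ∑ c ∈ S.image cnt, g c * ∑ u ∈ typeClass pj n γ x c, prodPMF pU n u := by
    rw [← Finset.sum_fiberwise_of_maps_to (t := S.image cnt) (g := cnt)
      (fun u hu => Finset.mem_image_of_mem _ hu)]
    refine Finset.sum_congr rfl fun c _ => ?_
    rw [hT, Finset.mul_sum]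
    refine Finset.sum_congr rfl fun u hu => ?_
    rw [hch, (Finset.mem_filter.mp hu).2, mul_comm]
  have e2 : ∑ m ∈ Finset.univ.filter (fun m => uw m ∈ S), chanN k n (uw m) x =
      ∑ c ∈ S.image cnt, g c *
        ((Finset.univ.filter (fun m => uw m ∈ typeClass pj n γ x c)).card : ℝ) := by
    rw [← Finset.sum_fiberwise_of_maps_to (t := S.image cnt) (g := fun m => cnt (uw m))
      (fun m hm => Finset.mem_image_of_mem _ (Finset.mem_filter.mp hm).2)]
    refine Finset.sum_congr rfl fun c _ => ?_
    have : Finset.univ.filter (fun m => uw m ∈ typeClass pj n γ x c) =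
        (Finset.univ.filter (fun m => uw m ∈ S)).filter (fun m => cnt (uw m) = c) := by
      ext m; simp [hT]
    rw [this, mul_comm, ← nsmul_eq_mul, ← Finset.sum_const]
    refine Finset.sum_congr rfl fun m hm => ?_
    rw [hch, (Finset.mem_filter.mp hm).2]
  rw [e1, e2, Finset.mul_sum, ← Finset.sum_sub_distrib, Finset.mul_sum]
  refine (Finset.abs_sum_le_sum_abs _ _).trans (Finset.sum_le_sum fun c hc => ?_)
  obtain ⟨u, hu, huc⟩ := Finset.mem_image.mp hc
  have hne : (typeClass pj n γ x c).Nonempty := ⟨u, by rw [hT]; simp [hu, huc]⟩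
  have h2 := mul_le_mul_of_nonneg_left (h c hne) (hg0 c)
  rw [← abs_of_nonneg (hg0 c), ← abs_mul, abs_of_nonneg (hg0 c)] at h2
  calc _ = _ := by congr 1; ring
    _ ≤ _ := h2
    _ = _ := by ring

/-- **Typical-part discrepancy bound (term `A₁ ≤ 1/(2n)`).**
Let the joint PMF on `𝒰 × 𝒳_J` be induced by `P_U` and the channel `P_{X_J|U}`.
If, for every typical `𝐱_J` and every nonempty joint type class `T ⊆ A_{U𝐱_J}`,
`|P_U^n(T) − |{m : 𝐮(m) ∈ T}|/N| ≤ n⁻¹·P_U^n(T)`, then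
`(1/2)·Σ_{𝐱_J ∈ A^{n,γ}_{X_J}} |Σ_{𝐮 ∈ A_{U𝐱_J}} P_U^n(𝐮)·P^n_{X_J|U}(𝐱_J|𝐮)
 − (1/N)·Σ_{m : 𝐮(m) ∈ A_{U𝐱_J}} P^n_{X_J|U}(𝐱_J|𝐮(m))| ≤ 1/(2n)`. -/
theorem typical_part_discrepancy_bound
    {U A : Type} [Fintype U] [Fintype A]
    (pU : U → ℝ) (hpU : IsPMF pU)
    (k : U → A → ℝ) (hk : ∀ u, IsPMF (k u))
    (γ : ℝ) (hγ : 0 < γ)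
    (n : ℕ) (hn : 1 ≤ n) (N : ℕ) (hN : 1 ≤ N)
    (uw : Fin N → Fin n → U)
    (hconc : ∀ xJ ∈ typ (margSnd (fun q : U × A => pU q.1 * k q.1 q.2)) n γ,
      ∀ c : U × A → ℕ,
        (typeClass (fun q : U × A => pU q.1 * k q.1 q.2) n γ xJ c).Nonempty →
        |(∑ u ∈ typeClass (fun q : U × A => pU q.1 * k q.1 q.2) n γ xJ c,
            prodPMF pU n u) -
          ((Finset.univ.filter (fun m =>
              uw m ∈ typeClass (fun q : U × A => pU q.1 * k q.1 q.2) n γ xJ c)).card : ℝ)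
            / N| ≤
          (n : ℝ)⁻¹ * ∑ u ∈ typeClass (fun q : U × A => pU q.1 * k q.1 q.2) n γ xJ c,
            prodPMF pU n u) :
    (1 / 2) * ∑ xJ ∈ typ (margSnd (fun q : U × A => pU q.1 * k q.1 q.2)) n γ,
      |(∑ u ∈ condTypSet (fun q : U × A => pU q.1 * k q.1 q.2) n γ xJ,
          prodPMF pU n u * chanN k n u xJ) -
        (1 / N : ℝ) * ∑ m ∈ Finset.univ.filter (fun m =>
            uw m ∈ condTypSet (fun q : U × A => pU q.1 * k q.1 q.2) n γ xJ),
          chanN k n (uw m) xJ| ≤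
      1 / (2 * n) := by
  have hch0 : ∀ u x, 0 ≤ chanN k n u x := fun u x =>
    Finset.prod_nonneg fun t _ => (hk _).1 _
  have hP0 : ∀ u, 0 ≤ prodPMF pU n u := fun u => Finset.prod_nonneg fun t _ => hpU.1 _
  have hn0 : (0 : ℝ) ≤ (n : ℝ)⁻¹ := by positivity
  have hb : ∀ xJ ∈ typ (margSnd (fun q : U × A => pU q.1 * k q.1 q.2)) n γ,
      |(∑ u ∈ condTypSet (fun q : U × A => pU q.1 * k q.1 q.2) n γ xJ,
          prodPMF pU n u * chanN k n u xJ) -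
        (1 / N : ℝ) * ∑ m ∈ Finset.univ.filter (fun m =>
            uw m ∈ condTypSet (fun q : U × A => pU q.1 * k q.1 q.2) n γ xJ),
          chanN k n (uw m) xJ| ≤
      (n : ℝ)⁻¹ * ∑ u, prodPMF pU n u * chanN k n u xJ := by
    intro x hx
    refine (aux_fiber pU k (fun u => (hk u).1) _ γ n N uw x (hconc x hx)).trans ?_
    refine mul_le_mul_of_nonneg_left ?_ hn0
    exact Finset.sum_le_sum_of_subset_of_nonneg (Finset.subset_univ _)
      fun u _ _ => mul_nonneg (hP0 u) (hch0 u x)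
  have htot : ∑ x : Fin n → A, ∑ u, prodPMF pU n u * chanN k n u x = 1 := by
    rw [Finset.sum_comm]
    have : ∀ u : Fin n → U, ∑ x : Fin n → A, prodPMF pU n u * chanN k n u x
        = prodPMF pU n u := by
      intro u
      rw [← Finset.mul_sum]
      have := aux_sum_prod n (fun t => k (u t)) (fun t => (hk _).2)
      unfold chanN
      rw [this, mul_one]
    simp_rw [this]
    exact aux_sum_prod n (fun _ => pU) (fun _ => hpU.2)
  have h1 := Finset.sum_le_sum hb
  have h2 : ∑ x ∈ typ (margSnd (fun q : U × A => pU q.1 * k q.1 q.2)) n γ,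
      (n : ℝ)⁻¹ * ∑ u, prodPMF pU n u * chanN k n u x ≤
      ∑ x : Fin n → A, (n : ℝ)⁻¹ * ∑ u, prodPMF pU n u * chanN k n u x :=
    Finset.sum_le_sum_of_subset_of_nonneg (Finset.subset_univ _)
      fun x _ _ => mul_nonneg hn0
        (Finset.sum_nonneg fun u _ => mul_nonneg (hP0 u) (hch0 u x))
  rw [← Finset.mul_sum, ← Finset.mul_sum, htot, mul_one] at h2
  rw [← Finset.mul_sum] at h1
  calc _ ≤ (1 / 2) * (n : ℝ)⁻¹ := mul_le_mul_of_nonneg_left (h1.trans h2) (by norm_num)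
    _ = _ := by rw [one_div, one_div, mul_inv]
end
end
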